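/- Let S ⊂ ℙ(V) be a reduced irreducible ruled surface of degree d ≥ 3 which is not a cone, with associated irreducible curve C ⊂ Gr(2,V) of degree d. Suppose a line w̄ of S belongs to the singular locus of S and w̄ does not correspond to a singular point of the curve C. Then C is contained in the projective tangent space T_{Gr, w̄} of Gr at w̄. -/

import Mathlib

namespace RQS

open MvPolynomial

open MvPolynomial

variable (K : Type) [Field K]

/-- Projective n-space modelled as the projectivization of `Fin n → K`
(so `PP K (n+1)` is ℙⁿ). -/
abbrev PP (n : ℕ) : Type := Projectivization K (Fin n → K)

variable {K}

/-- Vanishing of a (homogeneous) polynomial at a projective point. -/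
def vanishes {n : ℕ} (p : MvPolynomial (Fin n) K) (x : PP K n) : Prop :=
  ∀ (v : Fin n → K) (h : v ≠ 0), Projectivization.mk K v h = x → eval v p = 0

/-- Projective zero locus of a set of polynomials. -/
def zeroLocus {n : ℕ} (S : Set (MvPolynomial (Fin n) K)) : Set (PP K n) :=
  {x | ∀ p ∈ S, vanishes p x}

/-- Zariski closed subsets of projective space. -/
def ZClosed {n : ℕ} (X : Set (PP K n)) : Prop :=
  ∃ S : Set (MvPolynomial (Fin n) K), (∀ p ∈ S, ∃ d, p.IsHomogeneous d) ∧ X = zeroLocus S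

/-- Irreducibility with respect to the Zariski topology. -/
def ZIrred {n : ℕ} (X : Set (PP K n)) : Prop :=
  X.Nonempty ∧ ∀ A B : Set (PP K n), ZClosed A → ZClosed B → X ⊆ A ∪ B → X ⊆ A ∨ X ⊆ B

/-- `X` contains a chain of closed irreducible subsets of length `d+1`. -/
def dimGE {n : ℕ} (X : Set (PP K n)) (d : ℕ) : Prop :=
  ∃ f : Fin (d + 1) → Set (PP K n),
    (∀ i, ZClosed (f i) ∧ ZIrred (f i) ∧ f i ⊆ X) ∧ StrictMono f

/-- `X` has (Krull) dimension exactly `d`. -/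
def HasDim {n : ℕ} (X : Set (PP K n)) (d : ℕ) : Prop := dimGE X d ∧ ¬ dimGE X (d + 1)

/-- The hyperplane with coefficient vector `φ`. -/
def hyp {n : ℕ} (φ : Fin n → K) : Set (PP K n) :=
  {x | ∀ (v : Fin n → K) (h : v ≠ 0), Projectivization.mk K v h = x → ∑ i, φ i * v i = 0}

/-- Degree of a (reduced) curve: every hyperplane not containing it meets it in at most `d`
points, and some hyperplane meets it in exactly `d` points. -/
def HasCurveDeg {n : ℕ} (X : Set (PP K n)) (d : ℕ) : Prop :=
  (∀ φ : Fin n → K, φ ≠ 0 → ¬ X ⊆ hyp φ →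
    (X ∩ hyp φ).Finite ∧ (X ∩ hyp φ).ncard ≤ d) ∧
  (∃ φ : Fin n → K, φ ≠ 0 ∧ ¬ X ⊆ hyp φ ∧ (X ∩ hyp φ).ncard = d)

/-- An irreducible projective curve of degree `d`. -/
def IsCurveOfDeg {n : ℕ} (X : Set (PP K n)) (d : ℕ) : Prop :=
  ZClosed X ∧ ZIrred X ∧ HasDim X 1 ∧ HasCurveDeg X d

/-- A property holds at a general point of `S`. -/
def GenericPts {n : ℕ} (S : Set (PP K n)) (Q : PP K n → Prop) : Prop :=
  ∃ T : Set (PP K n), ZClosed T ∧ ¬ S ⊆ T ∧ ∀ p ∈ S, p ∉ T → Q p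

/-! ### Plücker coordinates: `p₁₂,p₁₃,p₁₄,p₂₃,p₂₄,p₃₄` indexed by `0,…,5` -/

/-- Plücker coordinates of the line through `u` and `v`, i.e. the bivector `u ∧ v`. -/
def plucker (u v : Fin 4 → K) : Fin 6 → K :=
  ![u 0 * v 1 - u 1 * v 0, u 0 * v 2 - u 2 * v 0, u 0 * v 3 - u 3 * v 0,
    u 1 * v 2 - u 2 * v 1, u 1 * v 3 - u 3 * v 1, u 2 * v 3 - u 3 * v 2]

/-- The Plücker quadric `p₁₂p₃₄ - p₁₃p₂₄ + p₁₄p₂₃`, i.e. `½ w ∧ w`. -/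
def plQuad (w : Fin 6 → K) : K := w 0 * w 5 - w 1 * w 4 + w 2 * w 3

/-- The wedge pairing `w ∧ z ∈ Λ⁴V ≅ K` of two bivectors. -/
def plPair (w z : Fin 6 → K) : K :=
  w 0 * z 5 + w 5 * z 0 - w 1 * z 4 - w 4 * z 1 + w 2 * z 3 + w 3 * z 2

/-- The wedge `w ∧ v ∈ Λ³V ≅ V*` of a bivector `w` with a vector `v`;
`w ∧ v = 0` expresses that the point `v̄` lies on the line `w̄`. -/
def wedgePt (w : Fin 6 → K) (v : Fin 4 → K) : Fin 4 → K :=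
  ![w 0 * v 2 - w 1 * v 1 + w 3 * v 0,
    w 0 * v 3 - w 2 * v 1 + w 4 * v 0,
    w 1 * v 3 - w 2 * v 2 + w 5 * v 0,
    w 3 * v 3 - w 4 * v 2 + w 5 * v 1]

/-- The set of points of ℙ³ on the line with Plücker vector `w`. -/
def lineOfRep (w : Fin 6 → K) : Set (PP K 4) :=
  {p | ∀ (v : Fin 4 → K) (h : v ≠ 0), Projectivization.mk K v h = p → wedgePt w v = 0}

/-- `w` represents a line of ℙ³: it is nonzero and decomposable. -/
def IsLineRep (w : Fin 6 → K) : Prop := w ≠ 0 ∧ plQuad w = 0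

variable (K) in
/-- The Grassmannian `Gr(2,4) ⊂ ℙ⁵` of lines in ℙ³. -/
def grass : Set (PP K 6) :=
  {x | ∃ (w : Fin 6 → K) (h : w ≠ 0), Projectivization.mk K w h = x ∧ plQuad w = 0}

/-- The line in ℙ³ corresponding to a point `x` of the Grassmannian. -/
def lineOf (x : PP K 6) : Set (PP K 4) :=
  {p | ∀ (w : Fin 6 → K) (h : w ≠ 0), Projectivization.mk K w h = x → p ∈ lineOfRep w}

/-- The set of (Grassmann points of) lines contained in a surface `S ⊂ ℙ³`. -/
def linesOf (S : Set (PP K 4)) : Set (PP K 6) :=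
  {x | x ∈ grass K ∧ lineOf x ⊆ S}

/-- A ruled surface: an irreducible closed surface which is a union of lines. -/
def IsRuled (S : Set (PP K 4)) : Prop :=
  ZClosed S ∧ ZIrred S ∧ HasDim S 2 ∧ ∀ p ∈ S, ∃ x ∈ linesOf S, p ∈ lineOf x

/-- Degree of a surface in ℙ³ via intersections with lines. -/
def HasSurfDeg (S : Set (PP K 4)) (d : ℕ) : Prop :=
  (∀ w : Fin 6 → K, IsLineRep w → ¬ lineOfRep w ⊆ S →
    (S ∩ lineOfRep w).Finite ∧ (S ∩ lineOfRep w).ncard ≤ d) ∧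
  (∃ w : Fin 6 → K, IsLineRep w ∧ ¬ lineOfRep w ⊆ S ∧ (S ∩ lineOfRep w).ncard = d)

/-- A cone: all lines of `S` pass through a common point. -/
def IsCone (S : Set (PP K 4)) : Prop :=
  ∃ p : PP K 4, ∀ x ∈ linesOf S, p ∈ lineOf x

/-- `σ₂(p₀)`: the 2-plane in the Grassmannian of all lines through `p₀`. -/
def sigma2 (p₀ : PP K 4) : Set (PP K 6) := {x | x ∈ grass K ∧ p₀ ∈ lineOf x}

/-- The projective tangent space `T_{Gr,x₀}` of the Plücker quadric at `x₀`,
namely the hyperplane `{z̄ : w₀ ∧ z = 0}`. -/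
def tangentGr (x₀ : PP K 6) : Set (PP K 6) :=
  {x | ∀ (w : Fin 6 → K) (h : w ≠ 0), Projectivization.mk K w h = x →
    ∀ (w₀ : Fin 6 → K) (h₀ : w₀ ≠ 0), Projectivization.mk K w₀ h₀ = x₀ → plPair w₀ w = 0}

/-- The linear span of (the representatives of) a subset of projective space. -/
def spanOfSet {n : ℕ} (X : Set (PP K n)) : Submodule K (Fin n → K) :=
  Submodule.span K {v | ∃ h : v ≠ 0, Projectivization.mk K v h ∈ X}

/-- The projective subspace associated to a linear subspace. -/
def projSub {n : ℕ} (U : Submodule K (Fin n → K)) : Set (PP K n) :=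
  {x | ∀ (v : Fin n → K) (h : v ≠ 0), Projectivization.mk K v h = x → v ∈ U}

/-- `P(C)`: the smallest projective subspace containing `C`. -/
def projSpanOf {n : ℕ} (X : Set (PP K n)) : Set (PP K n) := projSub (spanOfSet X)

/-! ### Smoothness via Jacobian criteria -/

/-- The homogeneous polynomials vanishing on `X`. -/
def homIdeal {n : ℕ} (X : Set (PP K n)) : Set (MvPolynomial (Fin n) K) :=
  {p | (∃ d, p.IsHomogeneous d) ∧ ∀ x ∈ X, vanishes p x}

/-- The span of the gradients at `v` of all homogeneous polynomials vanishing on `X`. -/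
def gradSpan {n : ℕ} (X : Set (PP K n)) (v : Fin n → K) : Submodule K (Fin n → K) :=
  Submodule.span K
    {g | ∃ p ∈ homIdeal X, g = fun i => eval v (pderiv i p)}

/-- Smooth point of a projective *curve* `X ⊂ ℙ(Kⁿ)` (Jacobian criterion:
the affine cone over `X` has a 2-dimensional tangent space there). -/
def CurveSmoothPt {n : ℕ} (X : Set (PP K n)) (x : PP K n) : Prop :=
  ∀ (v : Fin n → K) (h : v ≠ 0), Projectivization.mk K v h = x →
    Module.finrank K (gradSpan X v) = n - 2

/-- Smooth point of a *surface* `S ⊂ ℙ³` (Jacobian criterion). -/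
def SurfSmoothPt (S : Set (PP K 4)) (x : PP K 4) : Prop :=
  ∀ (v : Fin 4 → K) (h : v ≠ 0), Projectivization.mk K v h = x →
    Module.finrank K (gradSpan S v) = 1

/-- The singular locus of a surface `S ⊂ ℙ³`. -/
def singLocus (S : Set (PP K 4)) : Set (PP K 4) := {x ∈ S | ¬ SurfSmoothPt S x}

section LineCoordinates

variable {A : Type*} [CommRing A]

/-- The wedge `w ∧ v` of a bivector and a vector, over an arbitrary commutative ring. -/
def wdg (w : Fin 6 → A) (v : Fin 4 → A) : Fin 4 → A :=
  ![w 0 * v 2 - w 1 * v 1 + w 3 * v 0,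
    w 0 * v 3 - w 2 * v 1 + w 4 * v 0,
    w 1 * v 3 - w 2 * v 2 + w 5 * v 0,
    w 3 * v 3 - w 4 * v 2 + w 5 * v 1]

/-- The contraction of a bivector `w` with a covector `ξ`. -/
def contr (ξ : Fin 4 → A) (w : Fin 6 → A) : Fin 4 → A :=
  ![-(ξ 1 * w 0 + ξ 2 * w 1 + ξ 3 * w 2),
    ξ 0 * w 0 - ξ 2 * w 3 - ξ 3 * w 4,
    ξ 0 * w 1 + ξ 1 * w 3 - ξ 3 * w 5,
    ξ 0 * w 2 + ξ 1 * w 4 + ξ 2 * w 5]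

lemma map_wdg {A' : Type*} [CommRing A'] (f : A →+* A') (w : Fin 6 → A) (v : Fin 4 → A)
    (j : Fin 4) : f (wdg w v j) = wdg (fun i => f (w i)) (fun i => f (v i)) j := by
  fin_cases j <;> simp [wdg]

lemma map_contr {A' : Type*} [CommRing A'] (f : A →+* A') (ξ : Fin 4 → A) (w : Fin 6 → A)
    (j : Fin 4) : f (contr ξ w j) = contr (fun i => f (ξ i)) (fun i => f (w i)) j := by
  fin_cases j <;> simp [contr]

lemma wdg_smul_left (c : A) (w : Fin 6 → A) (v : Fin 4 → A) :
    wdg (c • w) v = c • wdg w v := by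
  ext j; fin_cases j <;> simp [wdg] <;> ring

lemma wdg_smul_right (c : A) (w : Fin 6 → A) (v : Fin 4 → A) :
    wdg w (c • v) = c • wdg w v := by
  ext j; fin_cases j <;> simp [wdg] <;> ring

end LineCoordinates

section LineGeometry

/-- Contraction of a fixed bivector as a linear map in the covector. -/
def contrLin (w : Fin 6 → K) : (Fin 4 → K) →ₗ[K] (Fin 4 → K) where
  toFun ξ := contr ξ w
  map_add' ξ η := by ext j; fin_cases j <;> simp [contr] <;> ring
  map_smul' c ξ := by ext j; fin_cases j <;> simp [contr] <;> ring

/-- Wedge with a fixed bivector as a linear map in the vector. -/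
def wdgLin (w : Fin 6 → K) : (Fin 4 → K) →ₗ[K] (Fin 4 → K) where
  toFun v := wdg w v
  map_add' ξ η := by ext j; fin_cases j <;> simp [wdg] <;> ring
  map_smul' c ξ := by ext j; fin_cases j <;> simp [wdg] <;> ring

lemma wdg_contr_self (w : Fin 6 → K) (hw : plQuad w = 0) (ξ : Fin 4 → K) :
    wdg w (contr ξ w) = 0 := by
  simp only [plQuad] at hw
  ext j
  fin_cases j <;> simp [wdg, contr] <;> grind

lemma wdg_contr_add (w t : Fin 6 → K) (h : plPair w t = 0) (ξ : Fin 4 → K) :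
    wdg w (contr ξ t) + wdg t (contr ξ w) = 0 := by
  simp only [plPair] at h
  ext j
  fin_cases j <;> simp [wdg, contr] <;> grind

lemma plPair_eq_zero_of_wdg (w z : Fin 6 → K) (p : Fin 4 → K) (hp : p ≠ 0)
    (hw : wdg w p = 0) (hz : wdg z p = 0) : plPair w z = 0 := by
  obtain ⟨k, hk⟩ := Function.ne_iff.mp hp
  have w0 := congrFun hw 0
  have w1 := congrFun hw 1
  have w2 := congrFun hw 2
  have w3 := congrFun hw 3
  have z0 := congrFun hz 0
  have z1 := congrFun hz 1
  have z2 := congrFun hz 2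
  have z3 := congrFun hz 3
  simp [wdg] at w0 w1 w2 w3 z0 z1 z2 z3
  apply mul_left_cancel₀ hk
  simp only [plPair]
  fin_cases k <;> simp <;> grind

lemma dot_contr (g ξ : Fin 4 → K) (w : Fin 6 → K) :
    ∑ i, g i * contr ξ w i = - ∑ i, ξ i * contr g w i := by
  simp [Fin.sum_univ_four, contr]; ring

lemma contr_wdg_row (w : Fin 6 → K) (hw : plQuad w = 0) (χ : Fin 4 → K) :
    contr (fun i => ∑ j, χ j * wdg w (Pi.single i 1) j) w = 0 := by
  simp only [plQuad] at hw
  ext j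
  fin_cases j <;> simp [wdg, contr, Fin.sum_univ_four] <;> grind

lemma exists_smul_of_wdg_contr (x w : Fin 6 → K) (hw0 : w ≠ 0) (hw : plQuad w = 0)
    (h : ∀ ξ, wdg x (contr ξ w) = 0) : ∃ c : K, x = c • w := by
  obtain ⟨k, hk⟩ := Function.ne_iff.mp hw0
  have h0 := h (Pi.single 0 1)
  have h1 := h (Pi.single 1 1)
  have h2 := h (Pi.single 2 1)
  have h3 := h (Pi.single 3 1)
  simp only [funext_iff, Fin.forall_fin_succ, wdg, contr] at h0 h1 h2 h3
  simp at h0 h1 h2 h3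
  obtain ⟨a0, a1, a2, a3⟩ := h0
  obtain ⟨b0, b1, b2, b3⟩ := h1
  obtain ⟨c0, c1, c2, c3⟩ := h2
  obtain ⟨d0, d1, d2, d3⟩ := h3
  have m01 : x 0 * w 1 = x 1 * w 0 := by linear_combination a0
  have m02 : x 0 * w 2 = x 2 * w 0 := by linear_combination a1
  have m12 : x 1 * w 2 = x 2 * w 1 := by linear_combination a2
  have m03 : x 0 * w 3 = x 3 * w 0 := by linear_combination b0
  have m04 : x 0 * w 4 = x 4 * w 0 := by linear_combination b1
  have m34 : x 3 * w 4 = x 4 * w 3 := by linear_combination b3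
  have m13 : x 1 * w 3 = x 3 * w 1 := by linear_combination c0
  have m15 : x 1 * w 5 = x 5 * w 1 := by linear_combination c2
  have m35 : x 3 * w 5 = x 5 * w 3 := by linear_combination c3
  have m24 : x 2 * w 4 = x 4 * w 2 := by linear_combination d1
  have m25 : x 2 * w 5 = x 5 * w 2 := by linear_combination d2
  have m45 : x 4 * w 5 = x 5 * w 4 := by linear_combination d3
  have m05 : x 0 * w 5 = x 5 * w 0 := by
    simp only [plQuad] at hw
    simp only [Pi.zero_apply] at hk
    apply mul_left_cancel₀ hk
    clear h hw0
    fin_cases k <;> simp only [Fin.isValue, Fin.zero_eta, Fin.mk_one, Fin.reduceFinMk] at hk ⊢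
    · grind
    · grind
    · grind
    · grind
    · grind
    · grind
  have m14 : x 1 * w 4 = x 4 * w 1 := by linear_combination b2 + c1 - m05
  have m23 : x 2 * w 3 = x 3 * w 2 := by linear_combination m14 - a3 - b2
  have key : ∀ i, x i * w k = x k * w i := by
    intro i
    fin_cases k <;> fin_cases i <;> first | rfl | assumption | (symm; assumption)
  refine ⟨x k / w k, ?_⟩
  ext i
  have := key i
  simp only [Pi.smul_apply, smul_eq_mul]
  simp only [Pi.zero_apply] at hk
  field_simp
  exact this

lemma two_le_finrank_range_of_pair (f : (Fin 4 → K) →ₗ[K] (Fin 4 → K)) (a b : Fin 4 → K)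
    (h : ∀ c d : K, c • f a + d • f b = 0 → c = 0 ∧ d = 0) :
    2 ≤ Module.finrank K (LinearMap.range f) := by
  have hli : LinearIndependent K ![(⟨f a, a, rfl⟩ : LinearMap.range f), ⟨f b, b, rfl⟩] := by
    rw [LinearIndependent.pair_iff]
    intro c d hcd
    exact h c d (congrArg Subtype.val hcd)
  simpa using hli.fintype_card_le_finrank

lemma two_le_finrank_range_wdgLin (w : Fin 6 → K) (hw0 : w ≠ 0) :
    2 ≤ Module.finrank K (LinearMap.range (wdgLin w)) := by
  obtain ⟨k, hk⟩ := Function.ne_iff.mp hw0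
  have key : ∃ i j : Fin 4, ∀ c d : K,
      c • wdg w (Pi.single i 1) + d • wdg w (Pi.single j 1) = 0 → c = 0 ∧ d = 0 := by
    simp only [funext_iff, Fin.forall_fin_succ, wdg]
    fin_cases k
    · refine ⟨2, 3, fun c d h => ?_⟩; simp at h hk; grind
    · refine ⟨1, 3, fun c d h => ?_⟩; simp at h hk; grind
    · refine ⟨1, 2, fun c d h => ?_⟩; simp at h hk; grind
    · refine ⟨0, 3, fun c d h => ?_⟩; simp at h hk; grind
    · refine ⟨0, 2, fun c d h => ?_⟩; simp at h hk; grind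
    · refine ⟨0, 1, fun c d h => ?_⟩; simp at h hk; grind
  obtain ⟨i, j, h⟩ := key
  exact two_le_finrank_range_of_pair (wdgLin w) _ _ h

lemma two_le_finrank_range_contrLin (w : Fin 6 → K) (hw0 : w ≠ 0) :
    2 ≤ Module.finrank K (LinearMap.range (contrLin w)) := by
  obtain ⟨k, hk⟩ := Function.ne_iff.mp hw0
  have key : ∃ i j : Fin 4, ∀ c d : K,
      c • contr (Pi.single i 1) w + d • contr (Pi.single j 1) w = 0 → c = 0 ∧ d = 0 := by
    simp only [funext_iff, Fin.forall_fin_succ, contr]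
    fin_cases k
    · refine ⟨0, 1, fun c d h => ?_⟩; simp at h hk; grind
    · refine ⟨0, 2, fun c d h => ?_⟩; simp at h hk; grind
    · refine ⟨0, 3, fun c d h => ?_⟩; simp at h hk; grind
    · refine ⟨1, 2, fun c d h => ?_⟩; simp at h hk; grind
    · refine ⟨1, 3, fun c d h => ?_⟩; simp at h hk; grind
    · refine ⟨2, 3, fun c d h => ?_⟩; simp at h hk; grind
  obtain ⟨i, j, h⟩ := key
  exact two_le_finrank_range_of_pair (contrLin w) _ _ h

/-- Every point of a line is a contraction of its Plücker vector. -/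
lemma exists_contr_eq (w : Fin 6 → K) (hw0 : w ≠ 0) (hw : plQuad w = 0) (v : Fin 4 → K)
    (hv : wdg w v = 0) : ∃ ξ, contr ξ w = v := by
  have hle : LinearMap.range (contrLin w) ≤ LinearMap.ker (wdgLin w) := by
    rintro _ ⟨ξ, rfl⟩
    exact wdg_contr_self w hw ξ
  have h1 := two_le_finrank_range_contrLin w hw0
  have h2 := two_le_finrank_range_wdgLin w hw0
  have h3 := LinearMap.finrank_range_add_finrank_ker (wdgLin w)
  rw [Module.finrank_fin_fun] at h3
  have heq := Submodule.eq_of_le_of_finrank_le hle (by omega)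
  have : v ∈ LinearMap.range (contrLin w) := by
    rw [heq]
    exact hv
  exact this

/-- A line through two directions: for `u ≠ 0`, some covector kills `u` but not the whole image
of `w ∧ ·`. -/
lemma exists_dual_wdg (w : Fin 6 → K) (hw0 : w ≠ 0) (u : Fin 4 → K) :
    ∃ χ : Fin 4 → K, ∑ j, χ j * u j = 0 ∧
      (fun i => ∑ j, χ j * wdg w (Pi.single i 1) j) ≠ 0 := by
  have h2 := two_le_finrank_range_wdgLin w hw0
  have hnle : ¬ LinearMap.range (wdgLin w) ≤ Submodule.span K {u} := by
    intro hle
    have h1 := Submodule.finrank_mono hle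
    have h3 : Module.finrank K (Submodule.span K {u}) ≤ 1 := by
      simpa using finrank_span_le_card (R := K) ({u} : Set (Fin 4 → K))
    omega
  obtain ⟨_, ⟨v, rfl⟩, hv⟩ := Set.not_subset.mp hnle
  obtain ⟨f, hf, hfu⟩ := Submodule.exists_le_ker_of_notMem hv
  have hfsum : ∀ x : Fin 4 → K, f x = ∑ j, f (Pi.single j 1) * x j := by
    intro x
    conv_lhs => rw [pi_eq_sum_univ' x]
    simp [mul_comm]
  refine ⟨fun j => f (Pi.single j 1), ?_, fun h0 => hf ?_⟩
  · rw [← hfsum]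
    exact hfu (Submodule.mem_span_singleton_self u)
  · have hv' : wdgLin w v = ∑ i, v i • wdgLin w (Pi.single i 1) := by
      conv_lhs => rw [pi_eq_sum_univ' v]
      simp
    rw [hv', map_sum]
    refine Finset.sum_eq_zero fun i _ => ?_
    have := congrFun h0 i
    simp only [← hfsum] at this
    rw [map_smul]
    change v i • f (wdg w (Pi.single i 1)) = 0
    rw [this]; simp

end LineGeometry

section LocalAlgebra

open IsLocalRing
open scoped Pointwise

variable {R B : Type*} [CommRing R] [CommRing B] [Algebra R B]

lemma one_sup_pow_succ_le (Y : Submodule R B) (D : ℕ) :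
    (1 ⊔ Y) ^ (D + 1) ≤ (1 ⊔ Y) ^ D ⊔ Y ^ (D + 1) := by
  induction D with
  | zero => simp
  | succ D ih =>
    calc (1 ⊔ Y) ^ (D + 1 + 1) = (1 ⊔ Y) ^ (D + 1) * (1 ⊔ Y) := pow_succ _ _
      _ ≤ ((1 ⊔ Y) ^ D ⊔ Y ^ (D + 1)) * (1 ⊔ Y) := by gcongr
      _ = (1 ⊔ Y) ^ (D + 1) ⊔ (Y ^ (D + 1) ⊔ Y ^ (D + 1 + 1)) := by
        rw [Submodule.sup_mul, ← pow_succ, Submodule.mul_sup, mul_one, ← pow_succ]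
      _ ≤ (1 ⊔ Y) ^ (D + 1) ⊔ Y ^ (D + 1 + 1) := by
        refine sup_le le_sup_left (sup_le (le_sup_of_le_left ?_) le_sup_right)
        exact pow_le_pow_left' le_sup_right _

lemma one_sup_pow_eq_top [IsLocalRing R] (Y : Submodule R B) (hfg : Y.FG) (D : ℕ)
    (hY : Y ^ (D + 1) ≤ maximalIdeal R • (1 ⊔ Y) ^ (D + 1))
    (hgen : Algebra.adjoin R (Y : Set B) = ⊤) : (1 ⊔ Y) ^ D = ⊤ := by
  have hV : (1 ⊔ Y).FG := Submodule.FG.sup (by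
    rw [Submodule.one_eq_span]
    exact Submodule.fg_span_singleton 1) hfg
  have hle : (1 ⊔ Y) ^ (D + 1) ≤ (1 ⊔ Y) ^ D :=
    Submodule.le_of_le_smul_of_le_jacobson_bot (hV.pow _) (maximalIdeal_le_jacobson _)
      ((one_sup_pow_succ_le Y D).trans (sup_le_sup_left hY _))
  have h1 : (1 : Submodule R B) ≤ (1 ⊔ Y) ^ D := by
    calc (1 : Submodule R B) = 1 ^ D := (one_pow D).symm
      _ ≤ _ := pow_le_pow_left' le_sup_left _
  rw [eq_top_iff]
  intro b _
  have hb : b ∈ Algebra.adjoin R (Y : Set B) := hgen ▸ Algebra.mem_top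
  suffices h : ∀ x ∈ Algebra.adjoin R (Y : Set B), ∀ a ∈ (1 ⊔ Y) ^ D, a * x ∈ (1 ⊔ Y) ^ D by
    simpa using h b hb 1 (h1 (Submodule.one_le.mp le_rfl))
  intro x hx
  induction hx using Algebra.adjoin_induction with
  | mem x hx =>
    intro a ha
    apply hle
    rw [pow_succ]
    exact Submodule.mul_mem_mul ha ((le_sup_right : Y ≤ 1 ⊔ Y) hx)
  | algebraMap r =>
    intro a ha
    rw [mul_comm, ← Algebra.smul_def]
    exact Submodule.smul_mem _ _ ha
  | add x y _ _ hx hy =>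
    intro a ha
    rw [mul_add]
    exact Submodule.add_mem _ (hx a ha) (hy a ha)
  | mul x y _ _ hx hy =>
    intro a ha
    rw [← mul_assoc]
    exact hy _ (hx a ha)

lemma map_mem_pow_of_mem_set_pow {A : Type*} [CommRing A] (f : A →* B) (s : Set A)
    (V : Submodule R B) (hs : ∀ x ∈ s, f x ∈ V) (n : ℕ) (x : A) (hx : x ∈ s ^ n) :
    f x ∈ V ^ n := by
  induction n generalizing x with
  | zero =>
    simp only [pow_zero, Set.mem_one] at hx
    subst hx
    rw [map_one, pow_zero]
    exact (Submodule.one_le.mp le_rfl)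
  | succ n ih =>
    rw [pow_succ] at hx
    obtain ⟨a, ha, b, hb, rfl⟩ := Set.mem_mul.mp hx
    rw [map_mul, pow_succ]
    exact Submodule.mul_mem_mul (ih a ha) (hs b hb)

lemma aeval_mem_pow_of_isHomogeneous {σ : Type*} [Algebra K B] [Algebra K R] [IsScalarTower K R B]
    (z : σ → B) (V : Submodule R B) (hz : ∀ i, z i ∈ V) {n : ℕ}
    {q : MvPolynomial σ K} (hq : q.IsHomogeneous n) : aeval z q ∈ V ^ n := by
  rw [← mem_homogeneousSubmodule, ← homogeneousSubmodule_one_pow,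
    homogeneousSubmodule_one_eq_span_X, Submodule.span_pow] at hq
  induction hq using Submodule.span_induction with
  | mem x hx =>
    refine map_mem_pow_of_mem_set_pow (aeval z : MvPolynomial σ K →ₐ[K] B).toMonoidHom
      (Set.range X) V ?_ n x hx
    rintro _ ⟨i, rfl⟩
    simpa using hz i
  | zero => simp
  | add x y _ _ hx hy => rw [map_add]; exact Submodule.add_mem _ hx hy
  | smul c x _ hx =>
    rw [map_smul, ← algebraMap_smul R c]
    exact Submodule.smul_mem _ _ hx

lemma homogeneousComponent_succ_mul {σ : Type*} (g ω : MvPolynomial σ K) (hω : ω.IsHomogeneous 1)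
    (n : ℕ) : homogeneousComponent (n + 1) (g * ω) = homogeneousComponent n g * ω := by
  conv_lhs => rw [← sum_homogeneousComponent g, Finset.sum_mul, map_sum]
  have h : ∀ k, homogeneousComponent (n + 1) (homogeneousComponent k g * ω) =
      if n = k then homogeneousComponent k g * ω else 0 := by
    intro k
    have := homogeneousComponent_of_mem (m := n + 1)
      (((homogeneousComponent_isHomogeneous k g).mul hω))
    rw [this]
    by_cases hk : n = k
    · simp [hk]
    · rw [if_neg (by omega), if_neg hk]
  simp only [h]
  rw [Finset.sum_ite_eq]
  split_ifs with hmem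
  · rfl
  · rw [homogeneousComponent_eq_zero, zero_mul]
    simp at hmem
    omega

lemma mul_wdg_mem_smul_pow (m : Ideal R) (V : Submodule R B) (z : Fin 6 → B) (hz : ∀ i, z i ∈ V)
    (x : Fin 4 → R) (hx : ∀ i, x i ∈ m) {n : ℕ} {a : B} (ha : a ∈ V ^ n) (j : Fin 4) :
    a * wdg z (fun i => algebraMap R B (x i)) j ∈ m • V ^ (n + 1) := by
  have key : ∀ i k, a * (z i * algebraMap R B (x k)) ∈ m • V ^ (n + 1) := by
    intro i k
    have : a * (z i * algebraMap R B (x k)) = x k • (a * z i) := by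
      rw [Algebra.smul_def]; ring
    rw [this, pow_succ]
    exact Submodule.smul_mem_smul (hx k) (Submodule.mul_mem_mul ha (hz i))
  fin_cases j <;> simp only [wdg, mul_add, mul_sub, Fin.zero_eta, Fin.mk_one, Fin.reduceFinMk,
    Matrix.cons_val] <;>
    exact Submodule.add_mem _ (Submodule.sub_mem _ (key _ _) (key _ _)) (key _ _)

lemma mem_ideal_pow_and_isHomogeneous_of_mem_set_pow {σ : Type*} (s : Set (MvPolynomial σ K))
    (hs : ∀ x ∈ s, x.IsHomogeneous 1) (n : ℕ) (x : MvPolynomial σ K) (hx : x ∈ s ^ n) :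
    x ∈ Ideal.span s ^ n ∧ x.IsHomogeneous n := by
  induction n generalizing x with
  | zero =>
    simp only [pow_zero, Set.mem_one] at hx
    subst hx
    exact ⟨by simp, isHomogeneous_one _ _⟩
  | succ n ih =>
    rw [pow_succ] at hx
    obtain ⟨a, ha, b, hb, rfl⟩ := Set.mem_mul.mp hx
    rw [pow_succ]
    exact ⟨Ideal.mul_mem_mul (ih a ha).1 (Ideal.subset_span hb), (ih a ha).2.mul (hs b hb)⟩

end LocalAlgebra

section FiniteFibre

open IsLocalRing
open scoped Pointwise

lemma wdg_X_isHomogeneous (p : Fin 4 → K) (j : Fin 4) :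
    (wdg (X : Fin 6 → MvPolynomial (Fin 6) K) (fun i => C (p i)) j).IsHomogeneous 1 := by
  have key : ∀ i k, (X i * C (p k) : MvPolynomial (Fin 6) K).IsHomogeneous 1 := fun i k => by
    simpa using (isHomogeneous_X K i).mul (isHomogeneous_C (Fin 6) (p k))
  fin_cases j <;> simp only [wdg, Fin.zero_eta, Fin.mk_one, Fin.reduceFinMk, Matrix.cons_val] <;>
    exact ((key _ _).sub (key _ _)).add (key _ _)

variable {R B : Type*} [CommRing R] [IsLocalRing R] [CommRing B] [Algebra R B] [Algebra K R]
  [Algebra K B] [IsScalarTower K R B]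

lemma exists_span_pow_le_maximalIdeal_smul (𝓘 : Ideal (MvPolynomial (Fin 6) K))
    (h𝓘 : ∀ f ∈ 𝓘, ∀ n, homogeneousComponent n f ∈ 𝓘)
    (z : Fin 6 → B) (x : Fin 4 → R) (p : Fin 4 → K) (θ : Fin 6 → K)
    (hz : ∀ f ∈ 𝓘, aeval z f = 0)
    (hx : ∀ i, x i - algebraMap K R (p i) ∈ maximalIdeal R)
    (hinc : ∀ j, wdg z (fun i => algebraMap R B (x i)) j = 0)
    (hθ : ∑ i, θ i • z i = 1) (w₀ : Fin 6 → K)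
    (hrad : ∀ i, X i - C (w₀ i) * ∑ k, C (θ k) * X k ∈
      (𝓘 ⊔ Ideal.span (Set.range (wdg X fun i => C (p i)))).radical) :
    ∃ D, Submodule.span R (Set.range fun i => z i - algebraMap K B (w₀ i)) ^ (D + 1) ≤
      maximalIdeal R •
        (1 ⊔ Submodule.span R (Set.range fun i => z i - algebraMap K B (w₀ i))) ^ (D + 1) := by
  set J := 𝓘 ⊔ Ideal.span (Set.range (wdg X fun i => C (p i)))
  set Y := Submodule.span R (Set.range fun i => z i - algebraMap K B (w₀ i)) with hY
  set l : Fin 6 → MvPolynomial (Fin 6) K := fun i => X i - C (w₀ i) * ∑ k, C (θ k) * X k with hl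
  obtain ⟨D, hD⟩ := Ideal.exists_pow_le_of_le_radical_of_fg (I := Ideal.span (Set.range l)) (J := J)
    (Ideal.span_le.mpr (by rintro _ ⟨i, rfl⟩; exact hrad i))
    (Submodule.fg_span (Set.finite_range l))
  refine ⟨D, ?_⟩
  have hV : ∀ i, z i ∈ 1 ⊔ Y := fun i => by
    have h1 : z i - algebraMap K B (w₀ i) ∈ Y := Submodule.subset_span ⟨i, rfl⟩
    have h2 : algebraMap K B (w₀ i) ∈ (1 : Submodule R B) := by
      rw [IsScalarTower.algebraMap_apply K R B]
      exact Submodule.mem_one.mpr ⟨_, rfl⟩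
    simpa using Submodule.add_mem_sup h2 h1
  have hl1 : ∀ q ∈ Set.range l, q.IsHomogeneous 1 := by
    rintro _ ⟨i, rfl⟩
    refine (isHomogeneous_X K i).sub ?_
    have : (∑ k, C (θ k) * X k : MvPolynomial (Fin 6) K).IsHomogeneous 1 :=
      IsHomogeneous.sum _ _ _ fun k _ => by
        simpa using (isHomogeneous_C (Fin 6) (θ k)).mul (isHomogeneous_X K k)
    simpa using (isHomogeneous_C (Fin 6) (w₀ i)).mul this
  have him : (Set.range fun i => z i - algebraMap K B (w₀ i)) = aeval z '' Set.range l := by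
    rw [← Set.range_comp]
    congr 1
    ext i
    simp only [hl, Function.comp, map_sub, aeval_X, map_mul, map_sum, algHom_C,
      ← Algebra.smul_def, hθ]
    rw [Algebra.smul_def, mul_one]
  have hpow : Y ^ (D + 1) = Submodule.span R (aeval z '' (Set.range l) ^ (D + 1)) := by
    rw [hY, Submodule.span_pow, him, Set.image_pow]
  rw [hpow, Submodule.span_le]
  rintro _ ⟨L, hL, rfl⟩
  obtain ⟨hLmem, hLhom⟩ := mem_ideal_pow_and_isHomogeneous_of_mem_set_pow _ hl1 _ _ hL
  have hLJ : L ∈ J := hD (Ideal.pow_le_pow_right (Nat.le_succ D) hLmem)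
  obtain ⟨F, hF, G, hG, rfl⟩ := Submodule.mem_sup.mp hLJ
  obtain ⟨c, rfl⟩ := Ideal.mem_span_range_iff_exists_fun.mp hG
  have h1 := homogeneousComponent_of_mem (m := D + 1) hLhom
  rw [if_pos rfl, map_add, map_sum] at h1
  simp only [homogeneousComponent_succ_mul _ _ (wdg_X_isHomogeneous p _)] at h1
  rw [SetLike.mem_coe, ← h1, map_add, hz _ (h𝓘 F hF _), zero_add, map_sum]
  refine Submodule.sum_mem _ fun j _ => ?_
  have h2 : aeval z (wdg X (fun i => C (p i)) j) =
      - wdg z (fun i => algebraMap R B (x i - algebraMap K R (p i))) j := by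
    have h3 := map_wdg (aeval z : MvPolynomial (Fin 6) K →ₐ[K] B).toRingHom X
      (fun i => C (p i)) j
    simp only [AlgHom.toRingHom_eq_coe, RingHom.coe_coe, aeval_X, algHom_C] at h3
    rw [h3, ← sub_eq_zero, sub_neg_eq_add, ← hinc j]
    simp only [map_sub, ← IsScalarTower.algebraMap_apply]
    fin_cases j <;> simp [wdg] <;> ring
  rw [map_mul, h2, mul_neg]
  exact Submodule.neg_mem _ (mul_wdg_mem_smul_pow _ _ z hV _ hx
    (aeval_mem_pow_of_isHomogeneous z _ hV (homogeneousComponent_isHomogeneous D (c j))) j)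

end FiniteFibre

section FibreLinearization

open IsLocalRing
open scoped Pointwise

lemma ideal_le_of_le_sup_sq {A : Type*} [CommRing A] {I M : Ideal A} (h : I ≤ M ⊔ I ^ 2) {n : ℕ}
    (hn : I ^ n ≤ M) : I ≤ M := by
  have key : ∀ k, I ≤ M ⊔ I ^ (k + 1) := by
    intro k
    induction k with
    | zero => simp
    | succ k ih =>
      refine h.trans (sup_le le_sup_left ?_)
      calc I ^ 2 = I * I := sq I
        _ ≤ I * (M ⊔ I ^ (k + 1)) := Ideal.mul_mono_right ih
        _ = I * M ⊔ I ^ (k + 1 + 1) := by rw [Ideal.mul_sup, ← pow_succ']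
        _ ≤ _ := sup_le_sup_right Ideal.mul_le_right _
  exact (key n).trans (sup_le le_rfl ((Ideal.pow_le_pow_right (Nat.le_succ n)).trans hn))

lemma sum_wdg_single_smul {A : Type*} [CommRing A] [Algebra K A] (p : Fin 4 → K) (y : Fin 6 → A)
    (j : Fin 4) : ∑ k, wdg (Pi.single k 1) p j • y k = wdg y (fun i => algebraMap K A (p i)) j := by
  fin_cases j <;> simp [wdg, Fin.sum_univ_six, Pi.single_apply, Algebra.smul_def] <;> ring

lemma sum_wdg_single_right_smul {A : Type*} [CommRing A] [Algebra K A] (w : Fin 6 → K)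
    (x : Fin 4 → A) (j : Fin 4) :
    ∑ i, wdg w (Pi.single i 1) j • x i = wdg (fun k => algebraMap K A (w k)) x j := by
  fin_cases j <;> simp [wdg, Fin.sum_univ_four, Pi.single_apply, Algebra.smul_def] <;> ring

lemma wdg_mem {A : Type*} [CommRing A] (I : Ideal A) (y : Fin 6 → A) (x : Fin 4 → A)
    (h : ∀ i k, y i * x k ∈ I) (j : Fin 4) : wdg y x j ∈ I := by
  fin_cases j <;> simp only [wdg, Fin.zero_eta, Fin.mk_one, Fin.reduceFinMk, Matrix.cons_val] <;>
    exact Ideal.add_mem _ (Ideal.sub_mem _ (h _ _) (h _ _)) (h _ _)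

lemma wdg_sub_left {A : Type*} [CommRing A] (y y' : Fin 6 → A) (x : Fin 4 → A) (j : Fin 4) :
    wdg (fun i => y i - y' i) x j = wdg y x j - wdg y' x j := by
  fin_cases j <;> simp [wdg] <;> ring

lemma wdg_sub_right {A : Type*} [CommRing A] (y : Fin 6 → A) (x x' : Fin 4 → A) (j : Fin 4) :
    wdg y (fun i => x i - x' i) j = wdg y x j - wdg y x' j := by
  fin_cases j <;> simp [wdg] <;> ring

variable {R B : Type*} [CommRing R] [IsLocalRing R] [CommRing B] [Algebra R B] [Algebra K R]
  [Algebra K B] [IsScalarTower K R B]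

lemma one_eq_zero_of_span_pow_le (z : Fin 6 → B) (θ : Fin 6 → R) (hθ : ∑ i, θ i • z i = 1) (D : ℕ)
    (hD : Submodule.span R (Set.range z) ^ (D + 1) ≤
      maximalIdeal R • (1 ⊔ Submodule.span R (Set.range z)) ^ (D + 1)) : (1 : B) = 0 := by
  set Y := Submodule.span R (Set.range z) with hY
  have h1 : (1 : Submodule R B) ≤ Y := by
    rw [Submodule.one_le, ← hθ]
    exact Submodule.sum_mem _ fun i _ => Submodule.smul_mem _ _ (Submodule.subset_span ⟨i, rfl⟩)
  rw [sup_eq_right.mpr h1] at hD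
  have hfg : (Y ^ (D + 1)).FG := (Submodule.fg_span (Set.finite_range z)).pow _
  have hbot := Submodule.eq_bot_of_le_smul_of_le_jacobson_bot _ _ hfg hD
    (maximalIdeal_le_jacobson _)
  have h2 : (1 : B) ∈ Y ^ (D + 1) := by
    apply Submodule.one_le.mp
    calc (1 : Submodule R B) = 1 ^ (D + 1) := (one_pow _).symm
      _ ≤ _ := pow_le_pow_left' h1 _
  simpa [hbot] using h2

lemma exists_linear_sub_mem_sq (z : Fin 6 → B) (x : Fin 4 → R) (p : Fin 4 → K)
    (hx : ∀ i, x i - algebraMap K R (p i) ∈ maximalIdeal R)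
    (hinc : ∀ j, wdg z (fun i => algebraMap R B (x i)) j = 0)
    (hgen : Algebra.adjoin R (Set.range z) = ⊤)
    (w t : Fin 6 → K) (hw0 : w ≠ 0) (hwp : wdg w p = 0) (htp : wdg t p ≠ 0)
    (htan : ∀ g : Fin 6 → K, ∑ i, g i * t i = 0 → ∑ i, g i • (z i - algebraMap K B (w i)) ∈
      Ideal.span (Set.range fun i => z i - algebraMap K B (w i)) ^ 2) (D : ℕ)
    (hD : Submodule.span R (Set.range fun i => z i - algebraMap K B (w i)) ^ (D + 1) ≤
      maximalIdeal R •
        (1 ⊔ Submodule.span R (Set.range fun i => z i - algebraMap K B (w i))) ^ (D + 1)) :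
    ∃ ψ : Fin 4 → K, ψ ≠ 0 ∧ ∃ q ∈ maximalIdeal R ^ 2,
      algebraMap R B (∑ i, ψ i • x i - q) = 0 := by
  set y : Fin 6 → B := fun i => z i - algebraMap K B (w i) with hy
  set Y := Submodule.span R (Set.range y) with hY
  set I := Ideal.span (Set.range y) with hI
  set M := (maximalIdeal R).map (algebraMap R B) with hM
  have hyI : ∀ i, y i ∈ I := fun i => Ideal.subset_span ⟨i, rfl⟩
  have hxM : ∀ i, algebraMap R B (x i) - algebraMap K B (p i) ∈ M := fun i => by
    rw [IsScalarTower.algebraMap_apply K R B, ← map_sub]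
    exact Ideal.mem_map_of_mem _ (hx i)
  have hwpB : ∀ j, wdg (fun i => algebraMap K B (w i)) (fun i => algebraMap K B (p i)) j = 0 :=
    fun j => by rw [← map_wdg, hwp]; simp
  have hsmul : ∀ N : Submodule R B, ∀ b ∈ maximalIdeal R • N, b ∈ M := fun N b hb => by
    refine Submodule.smul_induction_on hb (fun r hr n _ => ?_) fun a b ha hb => Ideal.add_mem _ ha hb
    rw [Algebra.smul_def]
    exact Ideal.mul_mem_right _ _ (Ideal.mem_map_of_mem _ hr)
  have hypM : ∀ j, wdg y (fun i => algebraMap K B (p i)) j ∈ M := fun j => by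
    have h1 : wdg y (fun i => algebraMap K B (p i)) j =
        - wdg z (fun i => algebraMap R B (x i) - algebraMap K B (p i)) j := by
      rw [wdg_sub_right, hinc, hy, wdg_sub_left, hwpB]; ring
    rw [h1]
    exact neg_mem (wdg_mem _ _ _ (fun i k => Ideal.mul_mem_left _ _ (hxM k)) j)
  have hIpow : I ^ (D + 1) ≤ M := by
    have hspan : I ^ (D + 1) = Ideal.span (Set.range y ^ (D + 1)) :=
      Submodule.span_pow (R := B) (Set.range y) (D + 1)
    rw [hspan, Ideal.span_le]
    intro b hb
    refine hsmul _ b (hD ?_)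
    rw [hY, Submodule.span_pow]
    exact Submodule.subset_span hb
  obtain ⟨j, hj⟩ : ∃ j, wdg t p j ≠ 0 := by
    by_contra! h
    exact htp (funext h)
  have hIM : I ≤ M := by
    refine ideal_le_of_le_sup_sq ?_ hIpow
    rw [hI, Ideal.span_le]
    rintro _ ⟨i, rfl⟩
    have h1 := htan (fun k => (Pi.single i (wdg t p j) : Fin 6 → K) k - t i * wdg (Pi.single k 1) p j) (by
      have := sum_wdg_single_smul p t j
      simp only [smul_eq_mul, Algebra.algebraMap_self, RingHom.id_apply] at this
      simp only [sub_mul, Finset.sum_sub_distrib, mul_assoc, ← Finset.mul_sum, this]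
      simp [Pi.single_apply, mul_comm])
    simp only [sub_smul, Finset.sum_sub_distrib, mul_smul, ← Finset.smul_sum] at h1
    rw [sum_wdg_single_smul p y j] at h1
    have h2 : ∑ k, (Pi.single i (wdg t p j) : Fin 6 → K) k • y k = wdg t p j • y i := by
      simp [Pi.single_apply]
    rw [h2] at h1
    have h3 : wdg t p j • y i ∈ M ⊔ I ^ 2 := by
      rw [← sub_add_cancel (wdg t p j • y i) (t i • wdg y (fun i => algebraMap K B (p i)) j)]
      refine Ideal.add_mem _ (Ideal.mem_sup_right h1) (Ideal.mem_sup_left ?_)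
      rw [Algebra.smul_def]
      exact Ideal.mul_mem_left _ _ (hypM j)
    have h4 : y i = algebraMap K B (wdg t p j)⁻¹ * (wdg t p j • y i) := by
      rw [← Algebra.smul_def, smul_smul, inv_mul_cancel₀ hj, one_smul]
    rw [SetLike.mem_coe, h4]
    exact Ideal.mul_mem_left _ _ h3
  have hgenY : Algebra.adjoin R (Y : Set B) = ⊤ := by
    rw [eq_top_iff, ← hgen]
    refine Algebra.adjoin_le ?_
    rintro _ ⟨i, rfl⟩
    have h1 : y i ∈ Algebra.adjoin R (Y : Set B) :=
      Algebra.subset_adjoin (Submodule.subset_span ⟨i, rfl⟩)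
    have h2 : algebraMap K B (w i) ∈ Algebra.adjoin R (Y : Set B) := by
      rw [IsScalarTower.algebraMap_apply K R B]
      exact Subalgebra.algebraMap_mem _ _
    simpa [hy] using add_mem h1 h2
  have htop := one_sup_pow_eq_top Y (Submodule.fg_span (Set.finite_range y)) D hD hgenY
  have hfg : (⊤ : Submodule R B).FG := by
    rw [← htop]
    refine Submodule.FG.pow (Submodule.FG.sup ?_ (Submodule.fg_span (Set.finite_range y))) D
    rw [Submodule.one_eq_span]
    exact Submodule.fg_span_singleton 1
  have hlift : ∀ b ∈ Algebra.adjoin R (Set.range z), ∃ r, b - algebraMap R B r ∈ M := by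
    intro b hb
    induction hb using Algebra.adjoin_induction with
    | mem b hb =>
      obtain ⟨i, rfl⟩ := hb
      exact ⟨algebraMap K R (w i), by
        rw [← IsScalarTower.algebraMap_apply]; exact hIM (hyI i)⟩
    | algebraMap r => exact ⟨r, by simp⟩
    | add a b _ _ ha hb =>
      obtain ⟨r, hr⟩ := ha
      obtain ⟨s, hs⟩ := hb
      exact ⟨r + s, by rw [map_add, add_sub_add_comm]; exact add_mem hr hs⟩
    | mul a b _ _ ha hb =>
      obtain ⟨r, hr⟩ := ha
      obtain ⟨s, hs⟩ := hb
      refine ⟨r * s, ?_⟩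
      have : a * b - algebraMap R B (r * s) =
          a * (b - algebraMap R B s) + algebraMap R B s * (a - algebraMap R B r) := by
        rw [map_mul]; ring
      rw [this]
      exact add_mem (Ideal.mul_mem_left _ _ hs) (Ideal.mul_mem_left _ _ hr)
  have hsurj : Function.Surjective (algebraMap R B) := by
    have hle : (⊤ : Submodule R B) ≤ 1 := by
      refine Submodule.le_of_le_smul_of_le_jacobson_bot hfg (maximalIdeal_le_jacobson _) ?_
      intro b _
      obtain ⟨r, hr⟩ := hlift b (hgen ▸ Algebra.mem_top)
      rw [← add_sub_cancel (algebraMap R B r) b]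
      refine Submodule.add_mem_sup (Submodule.mem_one.mpr ⟨r, rfl⟩) ?_
      rw [Ideal.smul_top_eq_map]
      exact hr
    intro b
    exact Submodule.mem_one.mp (hle (Submodule.mem_top : b ∈ ⊤))
  obtain ⟨χ, hχ, hψ⟩ := exists_dual_wdg w hw0 (wdg t p)
  refine ⟨_, hψ, ?_⟩
  have hmem : algebraMap R B (∑ i, (∑ j, χ j * wdg w (Pi.single i 1) j) • x i) ∈ M ^ 2 := by
    have h1 : algebraMap R B (∑ i, (∑ j, χ j * wdg w (Pi.single i 1) j) • x i) =
        ∑ j, χ j • wdg (fun k => algebraMap K B (w k)) (fun i => algebraMap R B (x i)) j := by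
      simp only [map_sum, ← sum_wdg_single_right_smul, Finset.smul_sum, smul_smul]
      rw [Finset.sum_comm]
      refine Finset.sum_congr rfl fun i _ => ?_
      rw [← Finset.sum_smul, ← IsScalarTower.coe_toAlgHom' K R B, map_smul]
    have h2 : ∀ j, wdg (fun k => algebraMap K B (w k)) (fun i => algebraMap R B (x i)) j =
        - wdg y (fun i => algebraMap R B (x i) - algebraMap K B (p i)) j
        - wdg y (fun i => algebraMap K B (p i)) j := fun j => by
      rw [wdg_sub_right, hy, wdg_sub_left, wdg_sub_left, hinc, hwpB]; ring
    have h3 := htan (fun k => ∑ j, χ j * wdg (Pi.single k 1) p j) (by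
      have h := sum_wdg_single_smul p t
      simp only [smul_eq_mul, Algebra.algebraMap_self, RingHom.id_apply] at h
      simp only [Finset.sum_mul]
      rw [Finset.sum_comm]
      simp only [mul_assoc, ← Finset.mul_sum, h, hχ])
    simp only [Finset.sum_smul] at h3
    rw [Finset.sum_comm] at h3
    simp only [mul_smul, ← Finset.smul_sum] at h3
    have h4 := fun j => sum_wdg_single_smul p y j
    simp only [hy] at h4
    simp only [h4] at h3
    simp only [h1, h2, smul_sub, smul_neg]
    rw [Finset.sum_sub_distrib]
    refine sub_mem (sum_mem fun j _ => ?_) (Ideal.pow_right_mono hIM 2 h3)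
    rw [Algebra.smul_def]
    refine neg_mem (Ideal.mul_mem_left _ _ (wdg_mem _ _ _ (fun i k => ?_) j))
    rw [sq]
    exact Ideal.mul_mem_mul (hIM (hyI i)) (hxM k)
  rw [hM, ← Ideal.map_pow] at hmem
  obtain ⟨q, hq, hq'⟩ := (Ideal.mem_map_iff_of_surjective _ hsurj).mp hmem
  exact ⟨q, hq, by rw [map_sub, hq', sub_self]⟩

end FibreLinearization

section Cones

lemma aeval_add_sub_sub_mem_sq {σ A : Type*} [Fintype σ] [CommRing A] [Algebra K A] (I : Ideal A)
    (w : σ → K) (y : σ → A) (hy : ∀ i, y i ∈ I) (f : MvPolynomial σ K) :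
    aeval (fun i => algebraMap K A (w i) + y i) f - algebraMap K A (eval w f)
      - ∑ i, eval w (pderiv i f) • y i ∈ I ^ 2 := by
  classical
  have hlin : ∀ g : MvPolynomial σ K, ∑ i, eval w (pderiv i g) • y i ∈ I := fun g =>
    sum_mem fun i _ => by
      rw [Algebra.smul_def]
      exact Ideal.mul_mem_left _ _ (hy i)
  induction f using MvPolynomial.induction_on with
  | C a => simp
  | add f g hf hg =>
    convert add_mem hf hg using 1
    simp only [map_add, add_smul, Finset.sum_add_distrib]
    ring
  | mul_X f j hf =>
    have h1 : ∑ i, eval w (pderiv i (f * X j)) • y i =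
        algebraMap K A (w j) * (∑ i, eval w (pderiv i f) • y i)
          + algebraMap K A (eval w f) * y j := by
      simp only [pderiv_mul, pderiv_X, map_add, map_mul, eval_X, add_smul, Finset.sum_add_distrib,
        Finset.mul_sum]
      congr 1
      · refine Finset.sum_congr rfl fun i _ => ?_
        simp only [Algebra.smul_def, map_mul]
        ring
      · rw [Finset.sum_eq_single j]
        · simp [Algebra.smul_def]
        · intro i _ hi
          simp [hi.symm]
        · simp
    set T := aeval (fun i => algebraMap K A (w i) + y i) f
    set L := ∑ i, eval w (pderiv i f) • y i
    rw [h1]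
    simp only [map_mul, aeval_X, eval_X]
    have h2 : T * (algebraMap K A (w j) + y j) - algebraMap K A (eval w f) * algebraMap K A (w j) -
        (algebraMap K A (w j) * L + algebraMap K A (eval w f) * y j) =
        (algebraMap K A (w j) + y j) * (T - algebraMap K A (eval w f) - L) + L * y j := by ring
    rw [h2]
    refine add_mem (Ideal.mul_mem_left _ _ hf) ?_
    rw [sq]
    exact Ideal.mul_mem_mul (hlin f) (hy j)

lemma eval_smul_of_isHomogeneous {σ : Type*} {d : ℕ} {f : MvPolynomial σ K}
    (hf : f.IsHomogeneous d) (c : K) (v : σ → K) : eval (c • v) f = c ^ d * eval v f := by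
  rw [eval_eq, eval_eq, Finset.mul_sum]
  refine Finset.sum_congr rfl fun m hm => ?_
  have h1 : m.degree = d := by
    rw [Finsupp.degree_eq_weight_one]
    exact hf (mem_support_iff.mp hm)
  rw [← h1, Finsupp.degree_apply, ← Finset.prod_pow_eq_pow_sum]
  simp only [Pi.smul_apply, smul_eq_mul, mul_pow, Finset.prod_mul_distrib]
  ring

lemma eval_homogeneousComponent_eq_zero [Infinite K] {σ : Type*} (f : MvPolynomial σ K) (v : σ → K)
    (h : ∀ c : K, c ≠ 0 → eval (c • v) f = 0) (n : ℕ) :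
    eval v (homogeneousComponent n f) = 0 := by
  set P : Polynomial K := ∑ k ∈ Finset.range (f.totalDegree + 1),
    Polynomial.C (eval v (homogeneousComponent k f)) * Polynomial.X ^ k with hP
  have hroot : ∀ c : K, c ≠ 0 → P.eval c = 0 := by
    intro c hc
    rw [← h c hc]
    conv_rhs => rw [← sum_homogeneousComponent f]
    simp only [hP, Polynomial.eval_finsetSum, Polynomial.eval_mul, Polynomial.eval_C,
      Polynomial.eval_pow, Polynomial.eval_X, map_sum,
      eval_smul_of_isHomogeneous (homogeneousComponent_isHomogeneous _ f)]
    exact Finset.sum_congr rfl fun _ _ => mul_comm _ _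
  have hP0 : P = 0 := Polynomial.eq_zero_of_infinite_isRoot P
    ((Set.finite_singleton (0 : K)).infinite_compl.mono fun c hc => hroot c hc)
  by_cases hn : n < f.totalDegree + 1
  · have h1 := congrArg (Polynomial.coeff · n) hP0
    simpa [hP, Polynomial.finsetSum_coeff, Polynomial.coeff_C_mul, Polynomial.coeff_X_pow, hn]
      using h1
  · rw [homogeneousComponent_eq_zero _ _ (by omega), map_zero]

/-- The polynomials vanishing on the punctured affine cone over `X`. -/
def coneIdeal {n : ℕ} (X : Set (PP K n)) : Ideal (MvPolynomial (Fin n) K) where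
  carrier := {f | ∀ (v : Fin n → K) (h : v ≠ 0), Projectivization.mk K v h ∈ X → eval v f = 0}
  add_mem' ha hb v h hv := by rw [map_add, ha v h hv, hb v h hv, add_zero]
  zero_mem' v h hv := map_zero _
  smul_mem' c f hf v h hv := by rw [smul_eq_mul, map_mul, hf v h hv, mul_zero]

lemma mk_smul_eq {n : ℕ} (v : Fin n → K) (h : v ≠ 0) (c : K) (hc : c ≠ 0) :
    Projectivization.mk K (c • v) (smul_ne_zero hc h) = Projectivization.mk K v h :=
  (Projectivization.mk_eq_mk_iff' K _ _ _ _).mpr ⟨c, rfl⟩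

lemma mem_coneIdeal_of_mem_homIdeal {n : ℕ} {X : Set (PP K n)} {f : MvPolynomial (Fin n) K}
    (hf : f ∈ homIdeal X) : f ∈ coneIdeal X := fun v h hv => hf.2 _ hv v h rfl

lemma homogeneousComponent_mem_homIdeal [Infinite K] {n : ℕ} {X : Set (PP K n)}
    {f : MvPolynomial (Fin n) K} (hf : f ∈ coneIdeal X) (k : ℕ) :
    homogeneousComponent k f ∈ homIdeal X := by
  refine ⟨⟨k, homogeneousComponent_isHomogeneous k f⟩, ?_⟩
  rintro _ hx v h rfl
  exact eval_homogeneousComponent_eq_zero f v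
    (fun c hc => hf (c • v) (smul_ne_zero hc h) (mk_smul_eq v h c hc ▸ hx)) k

lemma vanishes_mk_of_eval {n d : ℕ} {f : MvPolynomial (Fin n) K} (hf : f.IsHomogeneous d)
    {v : Fin n → K} (h : v ≠ 0) (hv : eval v f = 0) : vanishes f (Projectivization.mk K v h) := by
  intro u hu huv
  obtain ⟨c, rfl⟩ := (Projectivization.mk_eq_mk_iff' K _ _ _ _).mp huv
  rw [eval_smul_of_isHomogeneous hf, hv, mul_zero]

lemma mk_mem_of_eval_homIdeal {n : ℕ} {X : Set (PP K n)} (hX : ZClosed X) {v : Fin n → K}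
    (h : v ≠ 0) (hv : ∀ f ∈ homIdeal X, eval v f = 0) : Projectivization.mk K v h ∈ X := by
  obtain ⟨T, hT, rfl⟩ := hX
  intro f hf
  obtain ⟨d, hd⟩ := hT f hf
  exact vanishes_mk_of_eval hd h (hv f ⟨⟨d, hd⟩, fun x hx => hx f hf⟩)

lemma zClosed_of_isHomogeneous {n d : ℕ} {f : MvPolynomial (Fin n) K} (hf : f.IsHomogeneous d) :
    ZClosed {x : PP K n | vanishes f x} :=
  ⟨{f}, by rintro _ rfl; exact ⟨d, hf⟩, by ext x; simp [zeroLocus]⟩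

lemma gradSpan_smul_le {n : ℕ} (X : Set (PP K n)) (v : Fin n → K) (c : K) :
    gradSpan X (c • v) ≤ gradSpan X v := by
  refine Submodule.span_le.mpr ?_
  rintro _ ⟨f, hf, rfl⟩
  obtain ⟨d, hd⟩ := hf.1
  have : (fun i => eval (c • v) (pderiv i f)) = c ^ (d - 1) • fun i => eval v (pderiv i f) := by
    ext i
    exact eval_smul_of_isHomogeneous hd.pderiv c v
  rw [this]
  exact Submodule.smul_mem _ _ (Submodule.subset_span ⟨f, hf, rfl⟩)

lemma gradSpan_smul {n : ℕ} (X : Set (PP K n)) (v : Fin n → K) (c : K) (hc : c ≠ 0) :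
    gradSpan X (c • v) = gradSpan X v := by
  refine le_antisymm (gradSpan_smul_le X v c) ?_
  simpa [smul_smul, inv_mul_cancel₀ hc] using gradSpan_smul_le X (c • v) c⁻¹

end Cones

section Lines

lemma mk_mem_lineOfRep {w : Fin 6 → K} {v : Fin 4 → K} (h : v ≠ 0) :
    Projectivization.mk K v h ∈ lineOfRep w ↔ wdg w v = 0 := by
  refine ⟨fun hv => hv v h rfl, fun hv u hu huv => ?_⟩
  obtain ⟨c, rfl⟩ := (Projectivization.mk_eq_mk_iff' K _ _ _ _).mp huv
  change wdg w (c • v) = 0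
  rw [wdg_smul_right, hv, smul_zero]

lemma lineOf_mk {w : Fin 6 → K} (hw : w ≠ 0) :
    lineOf (Projectivization.mk K w hw) = lineOfRep w := by
  ext x
  refine ⟨fun hx => hx w hw rfl, fun hx u hu huw => ?_⟩
  obtain ⟨c, rfl⟩ := (Projectivization.mk_eq_mk_iff' K _ _ _ _).mp huw
  intro v hv hvx
  change wdg (c • w) v = 0
  have h : wdg w v = 0 := hx v hv hvx
  rw [wdg_smul_left, h, smul_zero]

lemma plQuad_eq_zero_of_mk_mem_grass {w : Fin 6 → K} (hw : w ≠ 0)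
    (h : Projectivization.mk K w hw ∈ grass K) : plQuad w = 0 := by
  obtain ⟨u, hu, huw, hq⟩ := h
  obtain ⟨c, rfl⟩ := (Projectivization.mk_eq_mk_iff' K _ _ _ _).mp huw.symm
  have : plQuad (c • u) = c ^ 2 * plQuad u := by simp [plQuad]; ring
  rw [this, hq, mul_zero]

lemma zClosed_lineOf (x : PP K 6) : ZClosed (lineOf x) := by
  induction x using Projectivization.ind with
  | h w hw =>
  have hhom : ∀ j, (wdg (fun i => C (w i)) (X : Fin 4 → MvPolynomial (Fin 4) K) j).IsHomogeneous
      1 := by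
    have key : ∀ i k, (C (w i) * X k : MvPolynomial (Fin 4) K).IsHomogeneous 1 := fun i k => by
      simpa using (isHomogeneous_C (Fin 4) (w i)).mul (isHomogeneous_X K k)
    intro j
    fin_cases j <;>
      simp only [wdg, Fin.zero_eta, Fin.mk_one, Fin.reduceFinMk, Matrix.cons_val] <;>
      exact ((key _ _).sub (key _ _)).add (key _ _)
  have heval : ∀ v j, eval v (wdg (fun i => C (w i)) (X : Fin 4 → MvPolynomial (Fin 4) K) j) =
      wdg w v j := fun v j => by
    rw [map_wdg]
    simp
  refine ⟨Set.range (wdg (fun i => C (w i)) X), ?_, ?_⟩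
  · rintro _ ⟨j, rfl⟩
    exact ⟨1, hhom j⟩
  · rw [lineOf_mk]
    ext p
    constructor
    · rintro hp _ ⟨j, rfl⟩ v hv hvp
      rw [heval]
      exact congrFun (hp v hv hvp) j
    · intro hp v hv hvp
      funext j
      have := hp _ ⟨j, rfl⟩ v hv hvp
      rwa [heval] at this

lemma ZClosed.union {n : ℕ} {A B : Set (PP K n)} (hA : ZClosed A) (hB : ZClosed B) :
    ZClosed (A ∪ B) := by
  obtain ⟨S, hS, rfl⟩ := hA
  obtain ⟨T, hT, rfl⟩ := hB
  refine ⟨Set.image2 (· * ·) S T, ?_, ?_⟩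
  · rintro _ ⟨f, hf, g, hg, rfl⟩
    obtain ⟨d, hd⟩ := hS f hf
    obtain ⟨e, he⟩ := hT g hg
    exact ⟨d + e, hd.mul he⟩
  · ext x
    constructor
    · rintro (hx | hx) _ ⟨f, hf, g, hg, rfl⟩ v hv hvx
      · simp [hx f hf v hv hvx]
      · simp [hx g hg v hv hvx]
    · intro hx
      by_contra h
      simp only [Set.mem_union, not_or] at h
      obtain ⟨h1, h2⟩ := h
      simp only [zeroLocus, Set.mem_ofPred, not_forall] at h1
      obtain ⟨f, hf, hfx⟩ := h1
      refine h2 fun g hg => ?_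
      obtain ⟨d, hd⟩ := hS f hf
      obtain ⟨e, he⟩ := hT g hg
      simp only [vanishes, not_forall] at hfx
      obtain ⟨v, hv, rfl, hfv⟩ := hfx
      refine vanishes_mk_of_eval he hv ?_
      have := hx _ ⟨f, hf, g, hg, rfl⟩ v hv rfl
      simpa [hfv] using this

lemma ZIrred.subset_or_exists_subset {n : ℕ} {ι : Type*} {S A : Set (PP K n)} (hS : ZIrred S)
    (hA : ZClosed A) {T : Set ι} (hT : T.Finite) (L : ι → Set (PP K n)) (hL : ∀ i, ZClosed (L i))
    (h : S ⊆ A ∪ ⋃ i ∈ T, L i) : S ⊆ A ∨ ∃ i ∈ T, S ⊆ L i := by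
  induction T, hT using Set.Finite.induction_on generalizing A with
  | empty => exact Or.inl (by simpa using h)
  | @insert a T _ _ ih =>
    rw [Set.biUnion_insert, ← Set.union_assoc] at h
    rcases ih (hA.union (hL a)) h with h | ⟨i, hi, h⟩
    · rcases hS.2 A (L a) hA (hL a) h with h | h
      · exact Or.inl h
      · exact Or.inr ⟨a, Set.mem_insert _ _, h⟩
    · exact Or.inr ⟨i, Set.mem_insert_of_mem _ hi, h⟩

lemma eq_of_lineOf_subset {x y : PP K 6} (hx : x ∈ grass K) (h : lineOf x ⊆ lineOf y) : x = y := by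
  induction x using Projectivization.ind with
  | h w hw =>
  induction y using Projectivization.ind with
  | h u hu =>
  rw [lineOf_mk, lineOf_mk] at h
  have hq := plQuad_eq_zero_of_mk_mem_grass hw hx
  obtain ⟨c, hc⟩ := exists_smul_of_wdg_contr u w hw hq fun ξ => by
    by_cases h0 : contr ξ w = 0
    · rw [h0]
      exact (wdgLin u).map_zero
    · exact (mk_mem_lineOfRep h0).mp (h ((mk_mem_lineOfRep h0).mpr (wdg_contr_self w hq ξ)))
  exact ((Projectivization.mk_eq_mk_iff' K _ _ _ _).mpr ⟨c, hc.symm⟩).symm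

/-- The pull-back of a polynomial on `V` along the contraction `z ↦ ξ ⌟ z`. -/
noncomputable def pullContr (ξ : Fin 4 → K) (H : MvPolynomial (Fin 4) K) :
    MvPolynomial (Fin 6) K :=
  aeval (contr (fun i => C (ξ i)) X) H

lemma aeval_pullContr {A : Type*} [CommRing A] [Algebra K A] (ξ : Fin 4 → K)
    (H : MvPolynomial (Fin 4) K) (z : Fin 6 → A) :
    aeval z (pullContr ξ H) = aeval (contr (fun i => algebraMap K A (ξ i)) z) H := by
  rw [pullContr, ← AlgHom.comp_apply, comp_aeval]
  congr 2
  funext j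
  have h := map_contr (aeval z : MvPolynomial (Fin 6) K →ₐ[K] A).toRingHom
    (fun i => C (ξ i)) X j
  simpa using h

lemma eval_pullContr (ξ : Fin 4 → K) (H : MvPolynomial (Fin 4) K) (z : Fin 6 → K) :
    eval z (pullContr ξ H) = eval (contr ξ z) H := by
  simpa [aeval_eq_eval] using aeval_pullContr ξ H z

lemma pullContr_isHomogeneous (ξ : Fin 4 → K) {H : MvPolynomial (Fin 4) K} {d : ℕ}
    (hH : H.IsHomogeneous d) : (pullContr ξ H).IsHomogeneous d := by
  have key : ∀ i k, (C (ξ i) * X k : MvPolynomial (Fin 6) K).IsHomogeneous 1 := fun i k => by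
    simpa using (isHomogeneous_C (Fin 6) (ξ i)).mul (isHomogeneous_X K k)
  have h := hH.aeval (contr (fun i => C (ξ i)) (X : Fin 6 → MvPolynomial (Fin 6) K)) (n := 1) (by
    intro j
    fin_cases j <;>
      simp only [contr, Fin.zero_eta, Fin.mk_one, Fin.reduceFinMk, Matrix.cons_val]
    · exact (((key _ _).add (key _ _)).add (key _ _)).neg
    · exact ((key _ _).sub (key _ _)).sub (key _ _)
    · exact ((key _ _).add (key _ _)).sub (key _ _)
    · exact ((key _ _).add (key _ _)).add (key _ _))
  rwa [one_mul] at h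

lemma linForm_isHomogeneous {n : ℕ} (θ : Fin n → K) :
    (∑ k, C (θ k) * X k : MvPolynomial (Fin n) K).IsHomogeneous 1 :=
  IsHomogeneous.sum _ _ _ fun k _ => by
    simpa using (isHomogeneous_C (Fin n) (θ k)).mul (isHomogeneous_X K k)

lemma eval_linForm {n : ℕ} (θ v : Fin n → K) :
    eval v (∑ k, C (θ k) * X k) = ∑ k, θ k * v k := by simp

/-- A polynomial vanishing on the lines of the chart `θ = 1` of the curve `Γ` vanishes on `S`. -/
lemma mem_coneIdeal_of_eval_eq_zero [Infinite K] {S : Set (PP K 4)} {Γ : Set (PP K 6)}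
    (hS : ZIrred S) (hruled : ∀ p ∈ S, ∃ x ∈ linesOf S, p ∈ lineOf x) (hΓS : Γ ⊆ linesOf S)
    (hΓ : ZIrred Γ) (hfin : (linesOf S \ Γ).Finite) (θ z₁ : Fin 6 → K) (hz₁ : z₁ ≠ 0)
    (hz₁Γ : Projectivization.mk K z₁ hz₁ ∈ Γ) (hθ : ∑ k, θ k * z₁ k ≠ 0)
    (G : MvPolynomial (Fin 4) K)
    (hG : ∀ (z : Fin 6 → K) (h : z ≠ 0), Projectivization.mk K z h ∈ Γ → ∑ k, θ k * z k = 1 →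
      ∀ v, wdg z v = 0 → eval v G = 0) : G ∈ coneIdeal S := by
  have hchart : ∀ n, ∀ (z : Fin 6 → K) (h : z ≠ 0), Projectivization.mk K z h ∈ Γ →
      ∑ k, θ k * z k ≠ 0 → ∀ v, wdg z v = 0 → eval v (homogeneousComponent n G) = 0 := by
    intro n z h hz hθz v hv
    refine eval_homogeneousComponent_eq_zero G v (fun c _ => ?_) n
    have hinv : (∑ k, θ k * z k)⁻¹ ≠ 0 := inv_ne_zero hθz
    refine hG ((∑ k, θ k * z k)⁻¹ • z) (smul_ne_zero hinv h) (mk_smul_eq z h _ hinv ▸ hz) ?_ _ ?_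
    · simp only [Pi.smul_apply, smul_eq_mul, mul_left_comm _ (∑ k, θ k * z k)⁻¹]
      rw [← Finset.mul_sum, inv_mul_cancel₀ hθz]
    · rw [wdg_smul_left, wdg_smul_right, hv, smul_zero, smul_zero]
  have hlines : ∀ n, ∀ (z : Fin 6 → K) (h : z ≠ 0), Projectivization.mk K z h ∈ Γ →
      ∀ v, wdg z v = 0 → eval v (homogeneousComponent n G) = 0 := by
    intro n z h hz v hv
    have hzq : ∀ (u : Fin 6 → K) (hu : u ≠ 0), Projectivization.mk K u hu ∈ Γ → plQuad u = 0 :=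
      fun u hu hmem => plQuad_eq_zero_of_mk_mem_grass hu (hΓS hmem).1
    obtain ⟨ξ, rfl⟩ := exists_contr_eq z h (hzq z h hz) v hv
    have hQ := pullContr_isHomogeneous ξ (homogeneousComponent_isHomogeneous n G)
    rcases hΓ.2 _ _ (zClosed_of_isHomogeneous hQ) (zClosed_of_isHomogeneous (linForm_isHomogeneous θ))
      (by
        intro x hx
        induction x using Projectivization.ind with
        | h u hu =>
        by_cases hθu : ∑ k, θ k * u k = 0
        · exact Or.inr (vanishes_mk_of_eval (linForm_isHomogeneous θ) hu (by rwa [eval_linForm]))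
        · refine Or.inl (vanishes_mk_of_eval hQ hu ?_)
          rw [eval_pullContr]
          exact hchart n u hu hx hθu _ (wdg_contr_self u (hzq u hu hx) ξ)) with hsub | hsub
    · rw [← eval_pullContr]
      exact hsub hz z h rfl
    · exact absurd (by rw [← eval_linForm]; exact hsub hz₁Γ z₁ hz₁ rfl) hθ
  have hcomp : ∀ n, S ⊆ {x | vanishes (homogeneousComponent n G) x} := by
    intro n
    have hhom := homogeneousComponent_isHomogeneous n G
    rcases hS.subset_or_exists_subset (zClosed_of_isHomogeneous hhom) hfin lineOf zClosed_lineOf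
      (by
        intro x hx
        obtain ⟨l, hl, hxl⟩ := hruled x hx
        by_cases hlΓ : l ∈ Γ
        · left
          induction l using Projectivization.ind with
          | h z hz =>
          induction x using Projectivization.ind with
          | h v hv =>
          rw [lineOf_mk, mk_mem_lineOfRep] at hxl
          exact vanishes_mk_of_eval hhom hv (hlines n z hz hlΓ v hxl)
        · exact Or.inr (Set.mem_biUnion ⟨hl, hlΓ⟩ hxl)) with h | ⟨l, hl, h⟩
    · exact h
    · obtain ⟨y, hy⟩ := hΓ.1
      exact absurd (eq_of_lineOf_subset (hΓS hy).1 ((hΓS hy).2.trans h) ▸ hy) hl.2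
  intro v hv hvS
  rw [← sum_homogeneousComponent G, map_sum]
  exact Finset.sum_eq_zero fun n _ => hcomp n hvS v hv rfl

end Lines

section Gradients

open DualNumber

lemma aeval_add_smul_eps {σ : Type*} [Fintype σ] (f : MvPolynomial σ K) (w t : σ → K) :
    aeval (fun i => algebraMap K K[ε] (w i) + t i • (ε : K[ε])) f =
      algebraMap K K[ε] (eval w f) + (∑ i, eval w (pderiv i f) * t i) • (ε : K[ε]) := by
  have h := aeval_add_sub_sub_mem_sq (Ideal.span {(ε : K[ε])}) w (fun i => t i • (ε : K[ε]))
    (fun i => by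
      rw [Algebra.smul_def]
      exact Ideal.mul_mem_left _ _ (Ideal.mem_span_singleton_self _)) f
  rw [Ideal.span_singleton_pow, eps_pow_two, Ideal.span_singleton_zero, Ideal.mem_bot,
    sub_sub, sub_eq_zero] at h
  rw [h, Finset.sum_smul]
  simp only [smul_smul]

lemma eq_zero_of_smul_eps_eq_zero {c : K} (h : c • (ε : K[ε]) = 0) : c = 0 := by
  simpa using congrArg TrivSqZeroExt.snd h

lemma eval_zero_of_mem_homIdeal {n : ℕ} {X : Set (PP K n)} (hX : X.Nonempty)
    {H : MvPolynomial (Fin n) K} (hH : H ∈ homIdeal X) : eval 0 H = 0 := by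
  obtain ⟨x, hx⟩ := hX
  induction x using Projectivization.ind with
  | h v hv =>
  obtain ⟨d, hd⟩ := hH.1
  rw [← zero_smul K v, eval_smul_of_isHomogeneous hd, hH.2 _ hx v hv rfl, mul_zero]

lemma eval_eq_zero_of_mem_line {S : Set (PP K 4)} (hS : S.Nonempty) {w : Fin 6 → K}
    (hwS : lineOfRep w ⊆ S) {H : MvPolynomial (Fin 4) K} (hH : H ∈ homIdeal S)
    {v : Fin 4 → K} (hv : wdg w v = 0) : eval v H = 0 := by
  by_cases h : v = 0
  · rw [h]
    exact eval_zero_of_mem_homIdeal hS hH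
  · exact hH.2 _ (hwS ((mk_mem_lineOfRep h).mpr hv)) v h rfl

lemma sum_pderiv_mul_line [Infinite K] {S : Set (PP K 4)} (hS : S.Nonempty) {w : Fin 6 → K}
    (hwS : lineOfRep w ⊆ S) {H : MvPolynomial (Fin 4) K} (hH : H ∈ homIdeal S)
    {p a : Fin 4 → K} (hp : wdg w p = 0) (ha : wdg w a = 0) :
    ∑ i, eval p (pderiv i H) * a i = 0 := by
  set P : Polynomial K := aeval (fun i => Polynomial.C (p i) + Polynomial.C (a i) * Polynomial.X) H
    with hP
  have hroot : ∀ τ, P.eval τ = 0 := fun τ => by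
    have h1 : P.eval τ = eval (p + τ • a) H := by
      rw [hP, ← Polynomial.coe_aeval_eq_eval, ← AlgHom.comp_apply, comp_aeval, ← aeval_eq_eval]
      have h : (fun i => Polynomial.aeval τ
          (Polynomial.C (p i) + Polynomial.C (a i) * Polynomial.X)) = p + τ • a := by
        funext i
        simp only [map_add, map_mul, Polynomial.aeval_C, Polynomial.aeval_X, Pi.add_apply,
          Pi.smul_apply, smul_eq_mul, Algebra.algebraMap_self, RingHom.id_apply]
        ring
      rw [h]
    rw [h1]
    refine eval_eq_zero_of_mem_line hS hwS hH ?_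
    change wdgLin w (p + τ • a) = 0
    rw [map_add, map_smul]
    change wdg w p + τ • wdg w a = 0
    rw [hp, ha, smul_zero, add_zero]
  have hP0 : P = 0 := Polynomial.funext fun τ => by rw [hroot, Polynomial.eval_zero]
  have h2 := congrArg (Polynomial.aeval (ε : K[ε])) hP0
  rw [map_zero, hP, ← AlgHom.comp_apply, comp_aeval] at h2
  have h3 : (fun i => Polynomial.aeval (ε : K[ε])
      (Polynomial.C (p i) + Polynomial.C (a i) * Polynomial.X)) =
      fun i => algebraMap K K[ε] (p i) + a i • (ε : K[ε]) := by
    funext i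
    simp [Algebra.smul_def]
  rw [h3, aeval_add_smul_eps, eval_eq_zero_of_mem_line hS hwS hH hp, map_zero, zero_add] at h2
  exact eq_zero_of_smul_eps_eq_zero h2

lemma pullContr_mem_homIdeal {S : Set (PP K 4)} (hS : S.Nonempty) {Γ : Set (PP K 6)}
    (hΓS : Γ ⊆ linesOf S) {H : MvPolynomial (Fin 4) K} (hH : H ∈ homIdeal S) (ξ : Fin 4 → K) :
    pullContr ξ H ∈ homIdeal Γ := by
  obtain ⟨d, hd⟩ := hH.1
  refine ⟨⟨d, pullContr_isHomogeneous ξ hd⟩, ?_⟩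
  rintro _ hx z hz rfl
  rw [eval_pullContr]
  have hl := (hΓS hx).2
  rw [lineOf_mk] at hl
  exact eval_eq_zero_of_mem_line hS hl hH
    (wdg_contr_self z (plQuad_eq_zero_of_mk_mem_grass hz (hΓS hx).1) ξ)

lemma sum_pderiv_pullContr (ξ : Fin 4 → K) (H : MvPolynomial (Fin 4) K) (w t : Fin 6 → K) :
    ∑ i, eval w (pderiv i (pullContr ξ H)) * t i =
      ∑ i, eval (contr ξ w) (pderiv i H) * contr ξ t i := by
  have h1 := aeval_add_smul_eps (pullContr ξ H) w t
  have h2 := aeval_add_smul_eps H (contr ξ w) (contr ξ t)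
  rw [aeval_pullContr, eval_pullContr] at h1
  have h3 : contr (fun i => algebraMap K K[ε] (ξ i))
      (fun i => algebraMap K K[ε] (w i) + t i • (ε : K[ε])) =
      fun i => algebraMap K K[ε] (contr ξ w i) + contr ξ t i • (ε : K[ε]) := by
    funext i
    simp only [Algebra.smul_def]
    rw [map_contr, map_contr]
    fin_cases i <;> simp [contr] <;> ring
  rw [h3, h2] at h1
  have h4 := add_left_cancel h1
  rw [← sub_eq_zero, ← sub_smul] at h4
  exact (sub_eq_zero.mp (eq_zero_of_smul_eps_eq_zero h4)).symm

lemma finrank_gradSpan_contr_le_one [Infinite K] {S : Set (PP K 4)} (hS : S.Nonempty)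
    {Γ : Set (PP K 6)} (hΓS : Γ ⊆ linesOf S) {w : Fin 6 → K} (hw0 : w ≠ 0)
    (hwΓ : Projectivization.mk K w hw0 ∈ Γ) {t : Fin 6 → K}
    (ht : ∀ g ∈ gradSpan Γ w, ∑ i, g i * t i = 0) (hwt : plPair w t = 0) {ξ : Fin 4 → K}
    (htp : wdg t (contr ξ w) ≠ 0) :
    Module.finrank K (gradSpan S (contr ξ w)) ≤ 1 := by
  have hwq := plQuad_eq_zero_of_mk_mem_grass hw0 (hΓS hwΓ).1
  have hwS : lineOfRep w ⊆ S := lineOf_mk hw0 ▸ (hΓS hwΓ).2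
  have hker : gradSpan S (contr ξ w) ≤ LinearMap.ker (contrLin w) := by
    refine Submodule.span_le.mpr ?_
    rintro _ ⟨H, hH, rfl⟩
    rw [SetLike.mem_coe, LinearMap.mem_ker]
    change contr (fun i => eval (contr ξ w) (pderiv i H)) w = 0
    funext i
    have h1 := sum_pderiv_mul_line hS hwS hH (wdg_contr_self w hwq ξ)
      (wdg_contr_self w hwq (Pi.single i 1))
    rw [dot_contr, neg_eq_zero] at h1
    simpa [Pi.single_apply] using h1
  have hc : ∀ g ∈ gradSpan S (contr ξ w), ∑ i, g i * contr ξ t i = 0 := by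
    intro g hg
    induction hg using Submodule.span_induction with
    | mem g hg =>
      obtain ⟨H, hH, rfl⟩ := hg
      rw [← sum_pderiv_pullContr]
      exact ht _ (Submodule.subset_span ⟨_, pullContr_mem_homIdeal hS hΓS hH ξ, rfl⟩)
    | zero => simp
    | add a b _ _ ha hb => simp [add_mul, Finset.sum_add_distrib, ha, hb]
    | smul c a _ ha => simp [mul_assoc, ← Finset.mul_sum, ha]
  have hwc : wdg w (contr ξ t) ≠ 0 := by
    intro h
    have := wdg_contr_add w t hwt ξ
    rw [h, zero_add] at this
    exact htp this
  obtain ⟨j, hj⟩ : ∃ j, wdg w (contr ξ t) j ≠ 0 := by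
    by_contra! h
    exact hwc (funext h)
  set g₀ : Fin 4 → K := fun i => ∑ k, (Pi.single j 1 : Fin 4 → K) k * wdg w (Pi.single i 1) k
    with hg₀
  have hg₀c : ∑ i, g₀ i * contr ξ t i ≠ 0 := by
    have h := sum_wdg_single_right_smul w (contr ξ t) j
    simp only [smul_eq_mul, Algebra.algebraMap_self, RingHom.id_apply] at h
    have h' : ∑ i, g₀ i * contr ξ t i = wdg w (contr ξ t) j := by
      rw [← h]
      simp [hg₀, Pi.single_apply]
    rwa [h']
  have hlt : gradSpan S (contr ξ w) < LinearMap.ker (contrLin w) :=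
    lt_of_le_of_ne hker fun heq => hg₀c (hc g₀ (heq ▸ contr_wdg_row w hwq (Pi.single j 1)))
  have h1 := Submodule.finrank_lt_finrank_of_lt hlt
  have h2 := two_le_finrank_range_contrLin w hw0
  have h3 := LinearMap.finrank_range_add_finrank_ker (contrLin w)
  rw [Module.finrank_fin_fun] at h3
  omega

/-- A point of the line `w` avoiding finitely many bivectors not proportional to `w`. -/
lemma exists_contr_wdg_ne_zero [Infinite K] {w : Fin 6 → K} (hw0 : w ≠ 0) (hwq : plQuad w = 0)
    {T : Set (Fin 6 → K)} (hT : T.Finite) (hTw : ∀ x ∈ T, ¬ ∃ c : K, x = c • w) :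
    ∃ ξ, contr ξ w ≠ 0 ∧ ∀ x ∈ T, wdg x (contr ξ w) ≠ 0 := by
  classical
  set s : Finset (Subspace K (Fin 4 → K)) := insert (LinearMap.ker (contrLin w))
    (hT.toFinset.image fun x => LinearMap.ker ((wdgLin x).comp (contrLin w))) with hs
  have htop : ⊤ ∉ s := by
    intro h
    rcases Finset.mem_insert.mp h with h | h
    · have h2 := two_le_finrank_range_contrLin w hw0
      rw [LinearMap.ker_eq_top.mp h.symm, LinearMap.range_zero, finrank_bot] at h2
      omega
    · obtain ⟨x, hx, hxk⟩ := Finset.mem_image.mp h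
      refine hTw x (hT.mem_toFinset.mp hx) (exists_smul_of_wdg_contr x w hw0 hwq fun ξ => ?_)
      have : ξ ∈ LinearMap.ker ((wdgLin x).comp (contrLin w)) := hxk ▸ Submodule.mem_top
      exact this
  have hne := Subspace.biUnion_ne_univ_of_top_notMem htop
  obtain ⟨ξ, hξ⟩ := (Set.ne_univ_iff_exists_notMem _).mp hne
  simp only [Set.mem_iUnion, not_exists] at hξ
  refine ⟨ξ, fun h => hξ _ (Finset.mem_insert_self _ _) h, fun x hx h => ?_⟩
  exact hξ _ (Finset.mem_insert_of_mem
    (Finset.mem_image_of_mem _ (hT.mem_toFinset.mpr hx))) h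

end Gradients

section LocalModel

open IsLocalRing

lemma exists_C_mul_mem_of_C_mem_map {σ A R : Type*} [CommRing A] [CommRing R] [Algebra A R]
    (M : Submonoid A) [IsLocalization M R] (I : Ideal (MvPolynomial σ A)) (a : A)
    (h : C (algebraMap A R a) ∈ I.map (map (algebraMap A R))) : ∃ m ∈ M, C (m * a) ∈ I := by
  let : Algebra (MvPolynomial σ A) (MvPolynomial σ R) := algebraMvPolynomial
  have halg : algebraMap (MvPolynomial σ A) (MvPolynomial σ R) = map (algebraMap A R) :=
    algebraMap_def
  rw [← halg] at h
  obtain ⟨⟨⟨f, hf⟩, ⟨_, m, hm, rfl⟩⟩, hfm⟩ :=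
    (IsLocalization.mem_map_algebraMap_iff (M.map (C (σ := σ))) (MvPolynomial σ R)).mp h
  have h1 : algebraMap (MvPolynomial σ A) (MvPolynomial σ R) (C (a * m)) = algebraMap _ _ f := by
    rw [← hfm, halg, map_C, map_mul, C_mul]
    simp
  obtain ⟨⟨_, m', hm', rfl⟩, hc⟩ := (IsLocalization.eq_iff_exists (M.map (C (σ := σ))) _).mp h1
  refine ⟨m' * m, mul_mem hm' hm, ?_⟩
  have h2 : C (m' * m * a) = C m' * f := by
    rw [← hc, ← C_mul]
    congr 1
    ring
  rw [h2]
  exact Ideal.mul_mem_left _ _ hf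

instance ker_eval_isPrime (p : Fin 4 → K) :
    (RingHom.ker (eval p : MvPolynomial (Fin 4) K →+* K)).IsPrime := RingHom.ker_isPrime _

/-- The equations of the incidence variety of pairs `(z, v)` with `z` a zero of `𝓘` normalized by
`θ = 1` and `v` on the line `z`. -/
noncomputable def incidenceIdeal (𝓘 : Ideal (MvPolynomial (Fin 6) K)) (θ : Fin 6 → K) :
    Ideal (MvPolynomial (Fin 6) (MvPolynomial (Fin 4) K)) :=
  Ideal.span (map C '' (𝓘 : Set (MvPolynomial (Fin 6) K)) ∪ Set.range (wdg X fun i => C (X i)) ∪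
    {∑ k, C (C (θ k)) * X k - 1})

/-- The coordinate ring of the incidence variety, base changed to an algebra `R` over the
coordinate ring of the base. -/
abbrev IncidenceRing (𝓘 : Ideal (MvPolynomial (Fin 6) K)) (θ : Fin 6 → K) (R : Type*) [CommRing R]
    [Algebra (MvPolynomial (Fin 4) K) R] : Type _ :=
  MvPolynomial (Fin 6) R ⧸
    (incidenceIdeal 𝓘 θ).map (map (algebraMap (MvPolynomial (Fin 4) K) R))

variable (𝓘 : Ideal (MvPolynomial (Fin 6) K)) (θ : Fin 6 → K) (p : Fin 4 → K)
variable (R : Type*) [CommRing R] [Algebra (MvPolynomial (Fin 4) K) R]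

/-- The tautological bivector of the incidence ring. -/
noncomputable def incidenceBivector (𝓘 : Ideal (MvPolynomial (Fin 6) K)) (θ : Fin 6 → K)
    (R : Type*) [CommRing R] [Algebra (MvPolynomial (Fin 4) K) R] :
    Fin 6 → IncidenceRing 𝓘 θ R :=
  fun i => Ideal.Quotient.mk _ (X i)

/-- The coordinates of the base point in `R`. -/
noncomputable def pointCoord (R : Type*) [CommRing R] [Algebra (MvPolynomial (Fin 4) K) R] :
    Fin 4 → R :=
  fun i => algebraMap (MvPolynomial (Fin 4) K) R (X i)

lemma mk_map_eq_zero {f : MvPolynomial (Fin 6) (MvPolynomial (Fin 4) K)}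
    (hf : f ∈ incidenceIdeal 𝓘 θ) :
    (Ideal.Quotient.mk ((incidenceIdeal 𝓘 θ).map
      (map (algebraMap (MvPolynomial (Fin 4) K) R))))
        (map (algebraMap (MvPolynomial (Fin 4) K) R) f) = 0 :=
  Ideal.Quotient.eq_zero_iff_mem.mpr (Ideal.mem_map_of_mem _ hf)

lemma adjoin_incidenceBivector :
    Algebra.adjoin R (Set.range (incidenceBivector 𝓘 θ R)) = ⊤ := by
  have h := congrArg (Subalgebra.map (Ideal.Quotient.mkₐ R
    ((incidenceIdeal 𝓘 θ).map (map (algebraMap (MvPolynomial (Fin 4) K) R)))))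
    (adjoin_range_X (R := R) (σ := Fin 6))
  rw [AlgHom.map_adjoin, ← Set.range_comp, Algebra.map_top,
    (AlgHom.range_eq_top _).mpr (Ideal.Quotient.mkₐ_surjective _ _)] at h
  exact h

lemma exists_mul_eval_eq_zero
    [IsLocalization.AtPrime R (RingHom.ker (eval p : MvPolynomial (Fin 4) K →+* K))]
    (G : MvPolynomial (Fin 4) K)
    (hG : algebraMap R (IncidenceRing 𝓘 θ R)
      (algebraMap (MvPolynomial (Fin 4) K) R G) = 0) :
    ∃ h, eval p h ≠ 0 ∧ ∀ z v, (∀ f ∈ 𝓘, eval z f = 0) → ∑ k, θ k * z k = 1 → wdg z v = 0 →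
      eval v (h * G) = 0 := by
  have h1 := Ideal.Quotient.eq_zero_iff_mem.mp hG
  obtain ⟨h, hh, hmem⟩ := exists_C_mul_mem_of_C_mem_map
    (RingHom.ker (eval p : MvPolynomial (Fin 4) K →+* K)).primeCompl _ G h1
  refine ⟨h, fun h0 => hh h0, fun z v hz hθ hzv => ?_⟩
  have hle : incidenceIdeal 𝓘 θ ≤ RingHom.ker (eval₂Hom (eval v) z) := by
    refine Ideal.span_le.mpr ?_
    rintro _ ((⟨f, hf, rfl⟩ | ⟨j, rfl⟩) | rfl)
    · rw [SetLike.mem_coe, RingHom.mem_ker, coe_eval₂Hom, eval₂_map]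
      have : (eval v).comp (C : K →+* MvPolynomial (Fin 4) K) = RingHom.id K := by ext; simp
      rw [this]
      exact hz f hf
    · rw [SetLike.mem_coe, RingHom.mem_ker, map_wdg]
      simpa using congrFun hzv j
    · rw [SetLike.mem_coe, RingHom.mem_ker]
      simp [hθ]
  simpa using hle hmem

lemma wdg_incidenceBivector (j : Fin 4) :
    wdg (incidenceBivector 𝓘 θ R) (fun i => algebraMap _ _ (pointCoord (K := K) R i)) j = 0 := by
  have h := mk_map_eq_zero 𝓘 θ R (f := wdg X (fun i => C (X i)) j)
    (Ideal.subset_span (Or.inl (Or.inr ⟨j, rfl⟩)))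
  rw [map_wdg, map_wdg] at h
  simp only [map_X, map_C] at h
  exact h

variable [Algebra K R] [IsScalarTower K (MvPolynomial (Fin 4) K) R]

lemma aeval_incidenceBivector (f : MvPolynomial (Fin 6) K) (hf : f ∈ 𝓘) :
    aeval (incidenceBivector 𝓘 θ R) f = 0 := by
  have h := mk_map_eq_zero 𝓘 θ R (f := map C f)
    (Ideal.subset_span (Or.inl (Or.inl ⟨f, hf, rfl⟩)))
  rw [← h, map_map, ← RingHom.comp_apply]
  change (aeval (incidenceBivector 𝓘 θ R)).toRingHom f =
    ((Ideal.Quotient.mk _).comp (map _)) f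
  congr 1
  ext i
  · simp only [RingHom.comp_apply, AlgHom.toRingHom_eq_coe, RingHom.coe_coe, aeval_C, map_C]
    rw [IsScalarTower.algebraMap_apply K R, IsScalarTower.algebraMap_apply K (MvPolynomial (Fin 4) K) R]
    rfl
  · simp [incidenceBivector]

lemma sum_incidenceBivector : ∑ i, θ i • incidenceBivector 𝓘 θ R i = 1 := by
  have h := mk_map_eq_zero 𝓘 θ R (f := ∑ k, C (C (θ k)) * X k - 1)
    (Ideal.subset_span (Or.inr rfl))
  rw [map_sub, map_sub, sub_eq_zero, map_one, map_one, map_sum, map_sum] at h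
  rw [← h]
  refine Finset.sum_congr rfl fun i _ => ?_
  rw [Algebra.smul_def (A := IncidenceRing 𝓘 θ R), map_mul, map_mul, map_X, map_C,
    IsScalarTower.algebraMap_apply K R, IsScalarTower.algebraMap_apply K (MvPolynomial (Fin 4) K) R]
  rfl

lemma pointCoord_sub_mem [IsLocalRing R]
    [IsLocalization.AtPrime R (RingHom.ker (eval p : MvPolynomial (Fin 4) K →+* K))] (i : Fin 4) :
    pointCoord (K := K) R i - algebraMap K R (p i) ∈ maximalIdeal R := by
  have h : pointCoord (K := K) R i - algebraMap K R (p i) =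
      algebraMap (MvPolynomial (Fin 4) K) R (X i - C (p i)) := by
    rw [map_sub, IsScalarTower.algebraMap_apply K (MvPolynomial (Fin 4) K) R]
    rfl
  rw [h, IsLocalization.AtPrime.to_map_mem_maximal_iff R
    (RingHom.ker (eval p : MvPolynomial (Fin 4) K →+* K))]
  simp [RingHom.mem_ker]

end LocalModel

section LocalConsequences

open IsLocalRing

variable {𝓘 : Ideal (MvPolynomial (Fin 6) K)} {θ : Fin 6 → K} {p : Fin 4 → K}

lemma exists_eval_ne_zero_of_empty_fibre (h𝓘 : ∀ f ∈ 𝓘, ∀ n, homogeneousComponent n f ∈ 𝓘)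
    (hrad : ∀ i, X i ∈ (𝓘 ⊔ Ideal.span (Set.range (wdg X fun i => C (p i)))).radical)
    (R : Type*) [CommRing R] [IsLocalRing R] [Algebra (MvPolynomial (Fin 4) K) R] [Algebra K R]
    [IsScalarTower K (MvPolynomial (Fin 4) K) R]
    [IsLocalization.AtPrime R (RingHom.ker (eval p : MvPolynomial (Fin 4) K →+* K))] :
    ∃ h : MvPolynomial (Fin 4) K, eval p h ≠ 0 ∧ ∀ z v, (∀ f ∈ 𝓘, eval z f = 0) →
      ∑ k, θ k * z k = 1 → wdg z v = 0 → eval v h = 0 := by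
  obtain ⟨D, hD⟩ := exists_span_pow_le_maximalIdeal_smul 𝓘 h𝓘 (incidenceBivector 𝓘 θ R)
    (pointCoord (K := K) R) p θ (aeval_incidenceBivector 𝓘 θ R) (pointCoord_sub_mem p R)
    (wdg_incidenceBivector 𝓘 θ R) (sum_incidenceBivector 𝓘 θ R) 0 (by simpa using hrad)
  simp only [Pi.zero_apply, map_zero, sub_zero] at hD
  have h1 : (1 : IncidenceRing 𝓘 θ R) = 0 :=
    one_eq_zero_of_span_pow_le (incidenceBivector 𝓘 θ R) (fun i => algebraMap K R (θ i))
      (by simpa using sum_incidenceBivector 𝓘 θ R) D hD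
  simpa using exists_mul_eval_eq_zero 𝓘 θ p R 1 (by simpa using h1)

lemma eval_pderiv_eq_zero_of_mem_ker_sq {f : MvPolynomial (Fin 4) K}
    (hf : f ∈ RingHom.ker (eval p : MvPolynomial (Fin 4) K →+* K) ^ 2) (i : Fin 4) :
    eval p (pderiv i f) = 0 := by
  rw [pow_two] at hf
  induction hf using Submodule.mul_induction_on' with
  | mem_mul_mem a ha b hb =>
    rw [RingHom.mem_ker] at ha hb
    simp [Derivation.leibniz, ha, hb]
  | add a _ b _ ha hb => simp [ha, hb]

lemma exists_gradient_ne_zero_of_simple_fibre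
    (h𝓘 : ∀ f ∈ 𝓘, ∀ n, homogeneousComponent n f ∈ 𝓘) {w t : Fin 6 → K} (hw0 : w ≠ 0)
    (hθw : ∑ k, θ k * w k = 1) (hw : ∀ f ∈ 𝓘, eval w f = 0) (hwp : wdg w p = 0)
    (htp : wdg t p ≠ 0)
    (ht : ∀ g : Fin 6 → K, ∑ i, g i * t i = 0 →
      g ∈ Submodule.span K {g | ∃ f ∈ 𝓘, g = fun i => eval w (pderiv i f)} ⊔
        Submodule.span K {θ})
    (hrad : ∀ i, X i - C (w i) * ∑ k, C (θ k) * X k ∈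
      (𝓘 ⊔ Ideal.span (Set.range (wdg X fun i => C (p i)))).radical)
    (R : Type*) [CommRing R] [IsLocalRing R] [Algebra (MvPolynomial (Fin 4) K) R] [Algebra K R]
    [IsScalarTower K (MvPolynomial (Fin 4) K) R]
    [IsLocalization.AtPrime R (RingHom.ker (eval p : MvPolynomial (Fin 4) K →+* K))] :
    ∃ G : MvPolynomial (Fin 4) K, (∃ i, eval p (pderiv i G) ≠ 0) ∧
      ∀ z v, (∀ f ∈ 𝓘, eval z f = 0) → ∑ k, θ k * z k = 1 → wdg z v = 0 → eval v G = 0 := by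
  obtain ⟨D, hD⟩ := exists_span_pow_le_maximalIdeal_smul 𝓘 h𝓘 (incidenceBivector 𝓘 θ R)
    (pointCoord (K := K) R) p θ (aeval_incidenceBivector 𝓘 θ R) (pointCoord_sub_mem p R)
    (wdg_incidenceBivector 𝓘 θ R) (sum_incidenceBivector 𝓘 θ R) w hrad
  let B := IncidenceRing 𝓘 θ R
  let z := incidenceBivector 𝓘 θ R
  let y : Fin 6 → B := fun i => z i - algebraMap K B (w i)
  let J : Ideal B := Ideal.span (Set.range y)
  have hθy : ∑ i, θ i • y i = 0 := by
    simp only [y, smul_sub, Finset.sum_sub_distrib]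
    rw [sum_incidenceBivector 𝓘 θ R]
    rw [sub_eq_zero, ← map_one (algebraMap K B), ← hθw, map_sum]
    refine Finset.sum_congr rfl fun i _ => ?_
    rw [map_mul, Algebra.smul_def (A := B)]
  have htan : ∀ g : Fin 6 → K, ∑ i, g i * t i = 0 → ∑ i, g i • y i ∈ J ^ 2 := by
    intro g hg
    let L : (Fin 6 → K) →ₗ[K] B := ∑ i, (LinearMap.proj i).smulRight (y i)
    have hL : ∀ g, L g = ∑ i, g i • y i := fun g => by simp [L]
    suffices h : Submodule.span K {g | ∃ f ∈ 𝓘, g = fun i => eval w (pderiv i f)} ⊔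
        Submodule.span K {θ} ≤ ((J ^ 2).restrictScalars K).comap L by
      have := h (ht g hg)
      rwa [Submodule.mem_comap, hL] at this
    refine sup_le (Submodule.span_le.mpr ?_) (Submodule.span_le.mpr ?_)
    · rintro _ ⟨f, hf, rfl⟩
      have h := aeval_add_sub_sub_mem_sq J w y (fun i => Ideal.subset_span ⟨i, rfl⟩) f
      have hz : (fun i => algebraMap K B (w i) + y i) = z := by
        funext i
        simp [y]
      rw [hz, aeval_incidenceBivector 𝓘 θ R f hf, hw f hf, map_zero, sub_zero, zero_sub,
        neg_mem_iff] at h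
      rw [SetLike.mem_coe, Submodule.mem_comap, hL]
      exact h
    · rintro _ rfl
      rw [SetLike.mem_coe, Submodule.mem_comap, hL, hθy]
      exact zero_mem _
  obtain ⟨ψ, hψ, q, hq, hψq⟩ := exists_linear_sub_mem_sq z (pointCoord (K := K) R) p
    (pointCoord_sub_mem p R) (wdg_incidenceBivector 𝓘 θ R) (adjoin_incidenceBivector 𝓘 θ R)
    w t hw0 hwp htp htan D hD
  rw [← IsLocalization.AtPrime.map_eq_maximalIdeal
    (RingHom.ker (eval p : MvPolynomial (Fin 4) K →+* K)) R, ← Ideal.map_pow] at hq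
  obtain ⟨⟨⟨q', hq'⟩, s⟩, hqs⟩ := (IsLocalization.mem_map_algebraMap_iff
    (RingHom.ker (eval p : MvPolynomial (Fin 4) K →+* K)).primeCompl R).mp hq
  let ℓ : MvPolynomial (Fin 4) K := ∑ i, C (ψ i) * X i
  have hℓ : algebraMap (MvPolynomial (Fin 4) K) R ℓ = ∑ i, ψ i • pointCoord (K := K) R i := by
    simp only [ℓ, map_sum, map_mul]
    refine Finset.sum_congr rfl fun i _ => ?_
    rw [Algebra.smul_def, IsScalarTower.algebraMap_apply K (MvPolynomial (Fin 4) K) R]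
    rfl
  have hs : eval p s.1 ≠ 0 := s.2
  have hG : algebraMap R B (algebraMap (MvPolynomial (Fin 4) K) R (s.1 * ℓ - q')) = 0 := by
    have h2 : algebraMap (MvPolynomial (Fin 4) K) R (s.1 * ℓ - q') =
        algebraMap (MvPolynomial (Fin 4) K) R s.1 * (∑ i, ψ i • pointCoord (K := K) R i - q) := by
      rw [map_sub, map_mul, hℓ, ← hqs]
      ring
    rw [h2, map_mul, hψq, mul_zero]
  obtain ⟨h, hh, hv⟩ := exists_mul_eval_eq_zero 𝓘 θ p R _ hG
  refine ⟨_, ?_, hv⟩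
  have hq0 : eval p q' = 0 := Ideal.pow_le_self two_ne_zero hq'
  have hG0 : eval p (s.1 * ℓ - q') = 0 := by
    simpa [hh] using hv w p hw hθw hwp
  have hℓ0 : eval p ℓ = 0 := by
    simpa [hq0, hs] using hG0
  obtain ⟨i, hi⟩ := Function.ne_iff.mp hψ
  refine ⟨i, ?_⟩
  have hdℓ : eval p (pderiv i ℓ) = ψ i := by
    simp [ℓ, Derivation.leibniz, pderiv_X, Pi.single_apply]
  rw [Derivation.leibniz, map_add, smul_eq_mul, smul_eq_mul, map_mul, map_mul, hG0, zero_mul,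
    add_zero, map_sub, map_sub, eval_pderiv_eq_zero_of_mem_ker_sq hq', Derivation.leibniz, map_add,
    smul_eq_mul, smul_eq_mul, map_mul, map_mul, hℓ0, hdℓ]
  simpa [hh, hs] using hi

end LocalConsequences

section Tangent

lemma mk_mem_tangentGr {w z : Fin 6 → K} (hw : w ≠ 0) (hz : z ≠ 0) (h : plPair w z = 0) :
    Projectivization.mk K z hz ∈ tangentGr (Projectivization.mk K w hw) := by
  intro u hu huz v hv hvw
  obtain ⟨a, rfl⟩ := (Projectivization.mk_eq_mk_iff' K _ _ _ _).mp huz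
  obtain ⟨b, rfl⟩ := (Projectivization.mk_eq_mk_iff' K _ _ _ _).mp hvw
  have : plPair (b • w) (a • z) = b * a * plPair w z := by
    simp only [plPair, Pi.smul_apply, smul_eq_mul]
    ring
  rw [this, h, mul_zero]

lemma tangentGr_mk {w : Fin 6 → K} (hw : w ≠ 0) :
    tangentGr (Projectivization.mk K w hw) = hyp ![w 5, -w 4, w 3, w 2, -w 1, w 0] := by
  have hsum : ∀ z : Fin 6 → K,
      ∑ i, (![w 5, -w 4, w 3, w 2, -w 1, w 0] : Fin 6 → K) i * z i = plPair w z := fun z => by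
    simp [Fin.sum_univ_succ, plPair]
    ring
  ext x
  induction x using Projectivization.ind with
  | h z hz =>
  refine ⟨fun hx v hv hvx => ?_, fun hx => ?_⟩
  · rw [hsum]
    exact hx v hv hvx w hw rfl
  · exact mk_mem_tangentGr hw hz (hsum z ▸ hx z hz rfl)

lemma HasCurveDeg.finite_inter_tangentGr {Γ : Set (PP K 6)} {d : ℕ} (hΓ : HasCurveDeg Γ d)
    {w : Fin 6 → K} (hw : w ≠ 0) (h : ¬ Γ ⊆ tangentGr (Projectivization.mk K w hw)) :
    (Γ ∩ tangentGr (Projectivization.mk K w hw)).Finite := by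
  rw [tangentGr_mk hw] at h ⊢
  refine (hΓ.1 _ (fun h0 => hw ?_) h).1
  have h0 := congrFun h0
  funext i
  fin_cases i
  · simpa using h0 5
  · simpa using h0 4
  · simpa using h0 3
  · simpa using h0 2
  · simpa using h0 1
  · simpa using h0 0

/-- A general point of the line `w` lies on no other line of `Γ` if `Γ` meets the tangent space
of the Grassmannian at `w` in finitely many points. -/
lemma exists_contr_forall_mem_line [Infinite K] {Γ : Set (PP K 6)} {w : Fin 6 → K} (hw : w ≠ 0)
    (hwq : plQuad w = 0) (hfin : (Γ ∩ tangentGr (Projectivization.mk K w hw)).Finite)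
    {T : Set (Fin 6 → K)} (hT : T.Finite) (hTw : ∀ x ∈ T, ¬ ∃ c : K, x = c • w) :
    ∃ ξ, contr ξ w ≠ 0 ∧ (∀ x ∈ T, wdg x (contr ξ w) ≠ 0) ∧
      ∀ (z : Fin 6 → K) (h : z ≠ 0), Projectivization.mk K z h ∈ Γ → wdg z (contr ξ w) = 0 →
        ∃ c : K, z = c • w := by
  obtain ⟨ξ, hξ, hξT⟩ := exists_contr_wdg_ne_zero hw hwq (T := T ∪ Projectivization.rep ''
    ((Γ ∩ tangentGr (Projectivization.mk K w hw)) \ {Projectivization.mk K w hw}))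
    (hT.union ((hfin.subset Set.sdiff_subset).image _)) (by
      rintro _ (hx | ⟨x, hx, rfl⟩)
      · exact hTw _ hx
      · rintro ⟨c, hc⟩
        refine hx.2 ?_
        rw [Set.mem_singleton_iff, ← x.mk_rep]
        exact (Projectivization.mk_eq_mk_iff' K _ _ _ _).mpr ⟨c, hc.symm⟩)
  refine ⟨ξ, hξ, fun x hx => hξT x (Or.inl hx), fun z hz hzΓ hzp => ?_⟩
  by_contra hzw
  have hpair : plPair w z = 0 :=
    plPair_eq_zero_of_wdg w z _ hξ (wdg_contr_self w hwq ξ) hzp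
  obtain ⟨a, ha⟩ := (Projectivization.mk_eq_mk_iff' K _ _ (Projectivization.rep_nonzero _) hz).mp
    (Projectivization.mk_rep (Projectivization.mk K z hz))
  refine hξT _ (Or.inr ⟨_, ⟨⟨hzΓ, mk_mem_tangentGr hw hz hpair⟩, fun h => hzw ?_⟩, rfl⟩) ?_
  · obtain ⟨c, hc⟩ := (Projectivization.mk_eq_mk_iff' K _ _ _ _).mp h
    exact ⟨c, hc.symm⟩
  · rw [← ha, wdg_smul_left, hzp, smul_zero]

lemma sub_mem_radical_of_forall_mem [IsAlgClosed K] {Γ : Set (PP K 6)} (hΓ : ZClosed Γ)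
    {p : Fin 4 → K} {u θ : Fin 6 → K}
    (h : ∀ (z : Fin 6 → K) (hz : z ≠ 0), Projectivization.mk K z hz ∈ Γ → wdg z p = 0 →
      ∀ i, z i = u i * ∑ k, θ k * z k) (i : Fin 6) :
    X i - C (u i) * ∑ k, C (θ k) * X k ∈
      (coneIdeal Γ ⊔ Ideal.span (Set.range (wdg X fun i => C (p i)))).radical := by
  rw [← vanishingIdeal_zeroLocus_eq_radical (K := K), mem_vanishingIdeal_iff]
  intro z hz
  have hzI : ∀ f ∈ coneIdeal Γ ⊔ Ideal.span (Set.range (wdg X fun i => C (p i))), eval z f = 0 :=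
    hz
  have hgoal : z i = u i * ∑ k, θ k * z k := by
    by_cases hz0 : z = 0
    · simp [hz0]
    refine h z hz0 (mk_mem_of_eval_homIdeal hΓ hz0 fun f hf =>
      hzI f (Ideal.mem_sup_left (mem_coneIdeal_of_mem_homIdeal hf))) (funext fun j => ?_) i
    have hj := hzI _ (Ideal.mem_sup_right (Ideal.subset_span ⟨j, rfl⟩))
    rw [map_wdg] at hj
    simpa using hj
  simpa [sub_eq_zero] using hgoal

lemma exists_forall_mem_iff_sum_mul_eq_zero {n : ℕ} {W : Submodule K (Fin n → K)}
    (hW : Module.finrank K W + 1 = n) :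
    ∃ t : Fin n → K, t ≠ 0 ∧ ∀ g, g ∈ W ↔ ∑ i, g i * t i = 0 := by
  have hlt : W < ⊤ := by
    refine lt_top_iff_ne_top.mpr fun h => ?_
    rw [h, finrank_top, Module.finrank_fin_fun] at hW
    omega
  obtain ⟨f, hf0, hf⟩ := W.exists_le_ker_of_lt_top hlt
  have hker := Module.Dual.finrank_ker_add_one_of_ne_zero hf0
  rw [Module.finrank_fin_fun] at hker
  have hWf : W = LinearMap.ker f := Submodule.eq_of_le_of_finrank_le hf (by omega)
  have hsum : ∀ g, f g = ∑ i, g i * f fun j => if i = j then 1 else 0 := f.pi_apply_eq_sum_univ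
  refine ⟨fun i => f fun j => if i = j then 1 else 0, fun h0 => hf0 ?_, fun g => ?_⟩
  · refine LinearMap.ext fun g => ?_
    rw [hsum]
    exact Finset.sum_eq_zero fun i _ => mul_eq_zero_of_right _ (congrFun h0 i)
  · rw [hWf, LinearMap.mem_ker, hsum]

lemma sum_mul_eq_zero_of_mem_gradSpan {n : ℕ} {X : Set (PP K n)} {w : Fin n → K} (hw : w ≠ 0)
    (hwX : Projectivization.mk K w hw ∈ X) {g : Fin n → K} (hg : g ∈ gradSpan X w) :
    ∑ i, g i * w i = 0 := by
  induction hg using Submodule.span_induction with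
  | mem g hg =>
    obtain ⟨f, hf, rfl⟩ := hg
    obtain ⟨d, hd⟩ := hf.1
    have h := congrArg (eval w) hd.sum_X_mul_pderiv
    simpa [hf.2 _ hwX w hw rfl, mul_comm] using h
  | zero => simp
  | add a b _ _ ha hb => simp [add_mul, Finset.sum_add_distrib, ha, hb]
  | smul c a _ ha => simp [mul_assoc, ← Finset.mul_sum, ha]

lemma plPair_eq_zero_of_forall_mem_gradSpan {Γ : Set (PP K 6)} (hΓ : Γ ⊆ grass K)
    {w t : Fin 6 → K} (ht : ∀ g ∈ gradSpan Γ w, ∑ i, g i * t i = 0) : plPair w t = 0 := by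
  let Q : MvPolynomial (Fin 6) K := X 0 * X 5 - X 1 * X 4 + X 2 * X 3
  have hQ : Q ∈ homIdeal Γ := by
    refine ⟨⟨2, ?_⟩, ?_⟩
    · have key : ∀ i j, (X i * X j : MvPolynomial (Fin 6) K).IsHomogeneous 2 := fun i j =>
        (isHomogeneous_X K i).mul (isHomogeneous_X K j)
      exact ((key _ _).sub (key _ _)).add (key _ _)
    · rintro _ hx z hz rfl
      simpa [Q, plQuad] using plQuad_eq_zero_of_mk_mem_grass hz (hΓ hx)
  have h := ht _ (Submodule.subset_span ⟨Q, hQ, rfl⟩)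
  simp [Q, Fin.sum_univ_succ, Derivation.leibniz, pderiv_X, Pi.single_apply] at h
  rw [← h]
  simp only [plPair]
  ring

end Tangent

section Main

lemma homogeneousComponent_mem_coneIdeal [Infinite K] {n : ℕ} {X : Set (PP K n)}
    {f : MvPolynomial (Fin n) K} (hf : f ∈ coneIdeal X) (k : ℕ) :
    homogeneousComponent k f ∈ coneIdeal X :=
  mem_coneIdeal_of_mem_homIdeal (homogeneousComponent_mem_homIdeal hf k)

lemma exists_sum_mul_eq_one {n : ℕ} {v : Fin n → K} (hv : v ≠ 0) :
    ∃ θ : Fin n → K, ∑ k, θ k * v k = 1 := by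
  obtain ⟨i, hi⟩ := Function.ne_iff.mp hv
  exact ⟨Pi.single i (v i)⁻¹, by simp [Pi.single_apply, inv_mul_cancel₀ hi]⟩

lemma gradSpan_ne_bot_of_mem_coneIdeal [Infinite K] {n : ℕ} {X : Set (PP K n)}
    {G : MvPolynomial (Fin n) K} (hG : G ∈ coneIdeal X) {v : Fin n → K} {i : Fin n}
    (hi : eval v (pderiv i G) ≠ 0) : gradSpan X v ≠ ⊥ := by
  intro hbot
  refine hi ?_
  rw [← sum_homogeneousComponent G, map_sum, map_sum]
  refine Finset.sum_eq_zero fun k _ => ?_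
  have h : (fun i => eval v (pderiv i (homogeneousComponent k G))) ∈ gradSpan X v :=
    Submodule.subset_span ⟨_, homogeneousComponent_mem_homIdeal hG k, rfl⟩
  rw [hbot, Submodule.mem_bot] at h
  exact congrFun h i

variable [IsAlgClosed K] {S : Set (PP K 4)} {Γ : Set (PP K 6)} {w : Fin 6 → K}

/-- A line of `S` outside the curve `Γ` meets infinitely many lines of `Γ`. -/
lemma mem_of_finite_inter_tangentGr (hS : IsRuled S) (hΓS : Γ ⊆ linesOf S) (hΓcl : ZClosed Γ)
    (hΓ : ZIrred Γ) (hfin : (linesOf S \ Γ).Finite) (hw : w ≠ 0)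
    (hwS : Projectivization.mk K w hw ∈ linesOf S)
    (hT : (Γ ∩ tangentGr (Projectivization.mk K w hw)).Finite) :
    Projectivization.mk K w hw ∈ Γ := by
  have : Infinite K := IsAlgClosed.instInfinite
  by_contra hwΓ
  have hwq := plQuad_eq_zero_of_mk_mem_grass hw hwS.1
  obtain ⟨ξ, hξ, -, hline⟩ := exists_contr_forall_mem_line hw hwq hT Set.finite_empty (by simp)
  obtain ⟨x, hx⟩ := hΓ.1
  obtain ⟨θ, hθ⟩ := exists_sum_mul_eq_one x.rep_nonzero
  have hrad := sub_mem_radical_of_forall_mem (p := contr ξ w) (u := 0) (θ := θ) hΓcl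
    fun z hz hzΓ hzp => by
      obtain ⟨c, rfl⟩ := hline z hz hzΓ hzp
      exact absurd (mk_smul_eq w hw c (left_ne_zero_of_smul hz) ▸ hzΓ) hwΓ
  obtain ⟨h, hh, hv⟩ := exists_eval_ne_zero_of_empty_fibre (θ := θ)
    (fun f hf => homogeneousComponent_mem_coneIdeal hf) (by simpa using hrad)
    (Localization.AtPrime (RingHom.ker (eval (contr ξ w) : MvPolynomial (Fin 4) K →+* K)))
  have hmem := mem_coneIdeal_of_eval_eq_zero hS.2.1 hS.2.2.2 hΓS hΓ hfin θ x.rep x.rep_nonzero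
    (x.mk_rep.symm ▸ hx) (hθ ▸ one_ne_zero) h
    fun z hz hzΓ hθz v hzv => hv z v (fun f hf => hf z hz hzΓ) hθz hzv
  refine hh (hmem _ hξ (hwS.2 ?_))
  rw [lineOf_mk, mk_mem_lineOfRep]
  exact wdg_contr_self w hwq ξ

/-- If `Γ` is smooth at `w` and not contained in the tangent space of the Grassmannian at `w`,
then `S` is smooth at a general point of the line `w`. -/
lemma exists_surfSmoothPt (hS : IsRuled S) (hΓS : Γ ⊆ linesOf S) (hΓcl : ZClosed Γ)
    (hΓ : ZIrred Γ) (hfin : (linesOf S \ Γ).Finite) (hw : w ≠ 0)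
    (hwΓ : Projectivization.mk K w hw ∈ Γ)
    (hsm : CurveSmoothPt Γ (Projectivization.mk K w hw))
    (hT : (Γ ∩ tangentGr (Projectivization.mk K w hw)).Finite) :
    ∃ x ∈ lineOfRep w, SurfSmoothPt S x := by
  have : Infinite K := IsAlgClosed.instInfinite
  have hwq := plQuad_eq_zero_of_mk_mem_grass hw (hΓS hwΓ).1
  obtain ⟨θ, hθ⟩ := exists_sum_mul_eq_one hw
  have hθΓ : θ ∉ gradSpan Γ w := fun h =>
    one_ne_zero (hθ.symm.trans (sum_mul_eq_zero_of_mem_gradSpan hw hwΓ h))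
  have hrank : Module.finrank K (gradSpan Γ w ⊔ Submodule.span K {θ} :
      Submodule K (Fin 6 → K)) + 1 = 6 := by
    rw [Submodule.finrank_sup_span_singleton hθΓ, hsm w hw rfl]
  obtain ⟨t, ht0, ht⟩ := exists_forall_mem_iff_sum_mul_eq_zero hrank
  have htΓ : ∀ g ∈ gradSpan Γ w, ∑ i, g i * t i = 0 := fun g hg =>
    (ht g).mp (Submodule.mem_sup_left hg)
  have htθ : ∑ i, θ i * t i = 0 :=
    (ht θ).mp (Submodule.mem_sup_right (Submodule.mem_span_singleton_self θ))
  have hθc : ∀ c : K, ∑ i, θ i * (c • w) i = c := fun c => by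
    simp only [Pi.smul_apply, smul_eq_mul, mul_left_comm _ c, ← Finset.mul_sum, hθ, mul_one]
  have htw : ¬ ∃ c : K, t = c • w := by
    rintro ⟨c, rfl⟩
    rw [hθc] at htθ
    exact ht0 (by rw [htθ, zero_smul])
  obtain ⟨ξ, hξ, hξt, hline⟩ := exists_contr_forall_mem_line hw hwq hT (Set.finite_singleton t)
    (by simpa using htw)
  have hwp : wdg w (contr ξ w) = 0 := wdg_contr_self w hwq ξ
  have hrad := sub_mem_radical_of_forall_mem (p := contr ξ w) (u := w) (θ := θ) hΓcl
    fun z hz hzΓ hzp i => by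
      obtain ⟨c, rfl⟩ := hline z hz hzΓ hzp
      rw [hθc, Pi.smul_apply, smul_eq_mul, mul_comm]
  have hspan : gradSpan Γ w ⊔ Submodule.span K {θ} ≤ Submodule.span K
      {g | ∃ f ∈ coneIdeal Γ, g = fun i => eval w (pderiv i f)} ⊔ Submodule.span K {θ} := by
    refine sup_le_sup_right (Submodule.span_mono ?_) _
    rintro _ ⟨f, hf, rfl⟩
    exact ⟨f, mem_coneIdeal_of_mem_homIdeal hf, rfl⟩
  obtain ⟨G, ⟨i, hi⟩, hG⟩ := exists_gradient_ne_zero_of_simple_fibre (t := t)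
    (fun f hf => homogeneousComponent_mem_coneIdeal hf) hw hθ (fun f hf => hf w hw hwΓ) hwp
    (hξt t rfl) (fun g hg => hspan ((ht g).mpr hg)) hrad
    (Localization.AtPrime (RingHom.ker (eval (contr ξ w) : MvPolynomial (Fin 4) K →+* K)))
  have hGS : G ∈ coneIdeal S := mem_coneIdeal_of_eval_eq_zero hS.2.1 hS.2.2.2 hΓS hΓ hfin θ w hw
    hwΓ (hθ ▸ one_ne_zero) G
    fun z hz hzΓ hθz v hzv => hG z v (fun f hf => hf z hz hzΓ) hθz hzv
  have hle := finrank_gradSpan_contr_le_one hS.2.1.1 hΓS hw hwΓ htΓ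
    (plPair_eq_zero_of_forall_mem_gradSpan (fun x hx => (hΓS hx).1) htΓ) (hξt t rfl)
  have hge := Submodule.one_le_finrank_iff.mpr (gradSpan_ne_bot_of_mem_coneIdeal hGS hi)
  refine ⟨Projectivization.mk K _ hξ, (mk_mem_lineOfRep hξ).mpr hwp, fun v hv hvx => ?_⟩
  obtain ⟨c, rfl⟩ := (Projectivization.mk_eq_mk_iff' K _ _ _ _).mp hvx
  rw [gradSpan_smul S _ c (left_ne_zero_of_smul hv)]
  exact le_antisymm hle hge

end Main

/-! STATEMENT 9: if a line `w̄` of `S` lies in the singular locus of `S` and does not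
correspond to a singular point of the curve `C`, then `C ⊆ T_{Gr,w̄}`. -/

theorem statement_9 (K : Type) [Field K] [IsAlgClosed K]
    (S : Set (PP K 4)) (d : ℕ) (hd : 3 ≤ d)
    (hruled : IsRuled S) (hdeg : HasSurfDeg S d) (hcone : ¬ IsCone S)
    -- `C` is the irreducible degree-`d` curve component of the set of lines on `S`:
    (C : Set (PP K 6)) (hCsub : C ⊆ linesOf S)
    (hCcl : ZClosed C) (hCirr : ZIrred C) (hCdim : HasDim C 1) (hCdeg : HasCurveDeg C d)
    (hfin : (linesOf S \ C).Finite)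
    -- `w` represents a line of the surface `S`:
    (w : Fin 6 → K) (hw0 : w ≠ 0) (hwq : plQuad w = 0)
    (hwS : Projectivization.mk K w hw0 ∈ linesOf S)
    -- the line `w̄` belongs to the singular locus of `S`:
    (hsing : lineOfRep w ⊆ singLocus S)
    -- and `w̄` does not correspond to a singular point of `C`:
    (hnotsingC : Projectivization.mk K w hw0 ∈ C →
      CurveSmoothPt C (Projectivization.mk K w hw0)) :
    C ⊆ tangentGr (Projectivization.mk K w hw0) := by
  by_contra hCT
  have hT := hCdeg.finite_inter_tangentGr hw0 hCT
  have hwC := mem_of_finite_inter_tangentGr hruled hCsub hCcl hCirr hfin hw0 hwS hT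
  obtain ⟨x, hx, hxS⟩ :=
    exists_surfSmoothPt hruled hCsub hCcl hCirr hfin hw0 hwC (hnotsingC hwC) hT
  exact (hsing hx).2 hxS

end RQS
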